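/- arXiv:2506.13979 — 4 statements merged into one kernel-verified Lean document; each statement's English description precedes it below -/
import Mathlib

section
/- Let G be a connected simple graph on a finite vertex set with at least one edge and with maximum degree Δ. Then the symmetric digraph ↔G admits a distinguishing arc-colouring with ⌈2√Δ⌉ colours having no monochromatic 2-path. -/
/-- A type-I proper arc-colouring of the symmetric digraph of `G`:
no monochromatic 2-cycle and no monochromatic 2-path. -/
def IsTypeIColouring {V : Type*} (G : SimpleGraph V) {k : ℕ} (c : V → V → Fin k) : Prop :=
  ∀ u v w : V, G.Adj u v → G.Adj v w → c u v ≠ c v w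

/-- An arc-colouring of the symmetric digraph of `G` with no monochromatic 2-path. -/
def NoMono2Path {V : Type*} (G : SimpleGraph V) {k : ℕ} (c : V → V → Fin k) : Prop :=
  ∀ u v w : V, G.Adj u v → G.Adj v w → w ≠ u → c u v ≠ c v w

/-- An arc-colouring is distinguishing if the identity is the only automorphism
of `G` preserving it. -/
def IsDistinguishing {V : Type*} (G : SimpleGraph V) {k : ℕ} (c : V → V → Fin k) : Prop :=
  ∀ φ : G ≃g G, (∀ u v : V, G.Adj u v → c (φ u) (φ v) = c u v) → ∀ x : V, φ x = x

/-- Vertices `v`, `w` have palettes `A`, `B`; the set of all ways to colour the two arcs between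
`v` and `u` and the two arcs between `w` and `u`, when `u` has a palette in `U`. -/
def arcCodes {α : Type*} [DecidableEq α] (U : Finset (Finset α)) (A B : Finset α) :
    Finset ((α × α) × (α × α)) :=
  U.biUnion fun Q => ((A \ Q) ×ˢ (Q \ A)) ×ˢ ((B \ Q) ×ˢ (Q \ B))

theorem eq_of_sdiff_eq {α : Type*} [DecidableEq α] {A Q R : Finset α}
    (h₁ : A \ Q = A \ R) (h₂ : Q \ A = R \ A) : Q = R := by
  ext x
  have e₁ := congrArg (x ∈ ·) h₁
  have e₂ := congrArg (x ∈ ·) h₂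
  simp only [Finset.mem_sdiff, eq_iff_iff] at e₁ e₂
  tauto

theorem card_sdiff_comm_of_card_eq {α : Type*} [DecidableEq α] {A Q : Finset α}
    (h : A.card = Q.card) : (A \ Q).card = (Q \ A).card := by
  have h₁ := Finset.card_sdiff_add_card_inter A Q
  have h₂ := Finset.card_sdiff_add_card_inter Q A
  rw [Finset.inter_comm] at h₂
  omega

theorem one_le_card_sdiff {α : Type*} [DecidableEq α] {A Q : Finset α}
    (h : A.card = Q.card) (hne : Q ≠ A) : 1 ≤ (Q \ A).card := by
  rw [Nat.one_le_iff_ne_zero, Ne, Finset.card_eq_zero, Finset.sdiff_eq_empty_iff_subset]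
  exact fun hs => hne (Finset.eq_of_subset_of_card_le hs h.le)

theorem card_arcCodes_comm {α : Type*} [DecidableEq α] (U : Finset (Finset α))
    (A B : Finset α) : (arcCodes U A B).card = (arcCodes U B A).card := by
  refine Finset.card_bij' (fun p _ => p.swap) (fun p _ => p.swap) ?_ ?_ ?_ ?_
  · simp only [arcCodes, Finset.mem_biUnion, Finset.mem_product, Prod.fst_swap, Prod.snd_swap]
    tauto
  · simp only [arcCodes, Finset.mem_biUnion, Finset.mem_product, Prod.fst_swap, Prod.snd_swap]
    tauto
  · simp
  · simp

theorem sum_le_card_arcCodes {α : Type*} [DecidableEq α] {m : ℕ} {U : Finset (Finset α)}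
    {A B : Finset α} (hA : A.card = m) (hB : B.card = m) (hU : ∀ Q ∈ U, Q.card = m) :
    ∑ Q ∈ U with (Q \ A).card = 1, (Q \ B).card ^ 2 ≤ (arcCodes U A B).card := by
  have hsub : (U.filter fun Q => (Q \ A).card = 1).biUnion
      (fun Q => ((A \ Q) ×ˢ (Q \ A)) ×ˢ ((B \ Q) ×ˢ (Q \ B))) ⊆ arcCodes U A B :=
    Finset.biUnion_subset_biUnion_of_subset_left _ (Finset.filter_subset _ _)
  refine le_trans (le_of_eq ?_) (Finset.card_le_card hsub)
  rw [Finset.card_biUnion]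
  · refine Finset.sum_congr rfl fun Q hQ => ?_
    rw [Finset.mem_filter] at hQ
    simp only [Finset.card_product]
    rw [card_sdiff_comm_of_card_eq (hA.trans (hU Q hQ.1).symm),
      card_sdiff_comm_of_card_eq (hB.trans (hU Q hQ.1).symm), hQ.2]
    ring
  · intro Q hQ R hR hne
    rw [Finset.mem_coe, Finset.mem_filter] at hQ hR
    rw [Function.onFun, Finset.disjoint_left]
    intro p hp hp'
    simp only [Finset.mem_product] at hp hp'
    apply hne
    have a₁ := (card_sdiff_comm_of_card_eq (hA.trans (hU Q hQ.1).symm)).trans hQ.2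
    have a₂ := (card_sdiff_comm_of_card_eq (hA.trans (hU R hR.1).symm)).trans hR.2
    have key : ∀ {S T : Finset α} {x : α}, S.card = 1 → T.card = 1 → x ∈ S → x ∈ T → S = T := by
      intro S T x hS hT hxS hxT
      obtain ⟨a, rfl⟩ := Finset.card_eq_one.1 hS
      obtain ⟨b, rfl⟩ := Finset.card_eq_one.1 hT
      rw [Finset.mem_singleton] at hxS hxT
      rw [← hxS, ← hxT]
    exact eq_of_sdiff_eq (key a₁ a₂ hp.1.1 hp'.1.1) (key hQ.2 hR.2 hp.1.2 hp'.1.2)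

theorem sixteen_le_card_arcCodes {α : Type*} [DecidableEq α] {m : ℕ} {U : Finset (Finset α)}
    {A B Q : Finset α} (hA : A.card = m) (hB : B.card = m) (hQ : Q.card = m) (hQU : Q ∈ U)
    (hQA : 2 ≤ (Q \ A).card) (hQB : 2 ≤ (Q \ B).card) : 16 ≤ (arcCodes U A B).card := by
  have hsub : ((A \ Q) ×ˢ (Q \ A)) ×ˢ ((B \ Q) ×ˢ (Q \ B)) ⊆ arcCodes U A B :=
    Finset.subset_biUnion_of_mem (fun Q => ((A \ Q) ×ˢ (Q \ A)) ×ˢ ((B \ Q) ×ˢ (Q \ B))) hQU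
  refine le_trans ?_ (Finset.card_le_card hsub)
  simp only [Finset.card_product]
  rw [card_sdiff_comm_of_card_eq (hA.trans hQ.symm), card_sdiff_comm_of_card_eq (hB.trans hQ.symm)]
  calc 16 = 2 * 2 * (2 * 2) := by norm_num
    _ ≤ _ := by gcongr

theorem min_le_card_arcCodes {α : Type*} [DecidableEq α] {m : ℕ} {U : Finset (Finset α)}
    {A B : Finset α} (hA : A.card = m) (hB : B.card = m) (hU : ∀ Q ∈ U, Q.card = m)
    (hAU : A ∉ U) (hBU : B ∉ U) : min 16 U.card ≤ (arcCodes U A B).card := by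
  by_cases hex : ∃ Q ∈ U, 2 ≤ (Q \ A).card ∧ 2 ≤ (Q \ B).card
  · obtain ⟨Q, hQ, h₁, h₂⟩ := hex
    exact (min_le_left _ _).trans (sixteen_le_card_arcCodes hA hB (hU Q hQ) hQ h₁ h₂)
  push Not at hex
  refine (min_le_right _ _).trans ?_
  have s₁ := sum_le_card_arcCodes hA hB hU
  have s₂ := sum_le_card_arcCodes hB hA hU
  rw [card_arcCodes_comm U B A] at s₂
  rw [Finset.sum_filter] at s₁ s₂
  have hsum : ∑ Q ∈ U, 2 ≤ ∑ Q ∈ U, ((if (Q \ A).card = 1 then (Q \ B).card ^ 2 else 0) +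
      if (Q \ B).card = 1 then (Q \ A).card ^ 2 else 0) := by
    refine Finset.sum_le_sum fun Q hQ => ?_
    have h₁ := one_le_card_sdiff (hA.trans (hU Q hQ).symm) (ne_of_mem_of_not_mem hQ hAU)
    have h₂ := one_le_card_sdiff (hB.trans (hU Q hQ).symm) (ne_of_mem_of_not_mem hQ hBU)
    have h₃ := hex Q hQ
    split_ifs with e₁ e₂ e₂
    · rw [e₁, e₂]; norm_num
    · nlinarith [show 2 ≤ (Q \ B).card by omega]
    · nlinarith [show 2 ≤ (Q \ A).card by omega]
    · omega
  rw [Finset.sum_add_distrib, Finset.sum_const, smul_eq_mul] at hsum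
  omega

theorem five_le_card_arcCodes {α : Type*} [DecidableEq α] {m : ℕ} {U : Finset (Finset α)}
    {A B Q : Finset α} (hA : A.card = m) (hB : B.card = m) (hU : ∀ Q ∈ U, Q.card = m)
    (hAU : A ∉ U) (hBU : B ∉ U) (hcard : 3 ≤ U.card) (hQ : Q ∈ U) (hQB : 2 ≤ (Q \ B).card) :
    5 ≤ (arcCodes U A B).card := by
  by_cases hex : ∃ Q ∈ U, 2 ≤ (Q \ A).card ∧ 2 ≤ (Q \ B).card
  · obtain ⟨Q, hQ, h₁, h₂⟩ := hex
    exact le_trans (by norm_num) (sixteen_le_card_arcCodes hA hB (hU Q hQ) hQ h₁ h₂)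
  push Not at hex
  have s₁ := sum_le_card_arcCodes hA hB hU
  have s₂ := sum_le_card_arcCodes hB hA hU
  rw [card_arcCodes_comm U B A] at s₂
  have hA1 : ∀ R ∈ U, 1 ≤ (R \ A).card := fun R hR =>
    one_le_card_sdiff (hA.trans (hU R hR).symm) (ne_of_mem_of_not_mem hR hAU)
  have hB1 : ∀ R ∈ U, 1 ≤ (R \ B).card := fun R hR =>
    one_le_card_sdiff (hB.trans (hU R hR).symm) (ne_of_mem_of_not_mem hR hBU)
  have hQA : (Q \ A).card = 1 := by
    have := hA1 Q hQ
    have := hex Q hQ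
    omega
  by_cases hR : ∃ R ∈ U, R ≠ Q ∧ (R \ A).card = 1
  · obtain ⟨R, hR, hne, hRA⟩ := hR
    have hle : ∑ S ∈ {Q, R}, (S \ B).card ^ 2 ≤
        ∑ S ∈ U with (S \ A).card = 1, (S \ B).card ^ 2 :=
      Finset.sum_le_sum_of_subset (by
        intro S hS
        simp only [Finset.mem_insert, Finset.mem_singleton] at hS
        rcases hS with rfl | rfl <;> simp [*])
    rw [Finset.sum_pair hne.symm] at hle
    nlinarith [hB1 R hR]
  · push Not at hR
    have hUe : ∑ S ∈ U.erase Q, 4 ≤ ∑ S ∈ U with (S \ B).card = 1, (S \ A).card ^ 2 := by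
      refine le_trans (Finset.sum_le_sum (g := fun S => (S \ A).card ^ 2) fun S hS => ?_)
        (Finset.sum_le_sum_of_subset fun S hS => ?_)
      all_goals
        rw [Finset.mem_erase] at hS
        have h₁ := hA1 S hS.2
        have h₂ := hB1 S hS.2
        have h₃ := hex S hS.2
        have h₄ := hR S hS.2 hS.1
      · nlinarith [show 2 ≤ (S \ A).card by omega]
      · exact Finset.mem_filter.2 ⟨hS.2, by omega⟩
    rw [Finset.sum_const, Finset.card_erase_of_mem hQ, smul_eq_mul] at hUe
    omega

theorem card_filter_not_disjoint_le : ∀ P ∈ Finset.powersetCard 2 (Finset.univ : Finset (Fin 5)),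
    ∀ Q ∈ Finset.powersetCard 2 (Finset.univ : Finset (Fin 5)), P ≠ Q →
      ((Finset.powersetCard 2 (Finset.univ : Finset (Fin 5))).filter fun R =>
        R ≠ P ∧ R ≠ Q ∧ ¬ Disjoint R P ∧ ¬ Disjoint R Q).card ≤ 4 := by
  set_option maxRecDepth 100000 in decide

theorem half_mul_sub_half_lt_choose : ∀ k : ℕ, 8 ≤ k → k / 2 * (k - k / 2) < (k - 2).choose (k / 2 - 1)
  | 0, h | 1, h | 2, h | 3, h | 4, h | 5, h | 6, h | 7, h => by omega
  | 8, _ | 9, _ => by decide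
  | k + 10, _ => by
    have ih := half_mul_sub_half_lt_choose (k + 8) (by omega)
    obtain ⟨j, hj⟩ : ∃ j, (k + 8) / 2 = j + 4 := ⟨k / 2, by omega⟩
    rw [show (k + 10) / 2 = j + 5 by omega]
    rw [hj] at ih
    rw [show k + 8 - 2 = k + 6 by omega, show j + 4 - 1 = j + 3 by omega] at ih
    rw [show k + 10 - 2 = (k + 6) + 1 + 1 by omega, show j + 5 - 1 = (j + 3) + 1 by omega]
    have h₁ := Nat.choose_succ_succ' (k + 6 + 1) (j + 3)
    have h₂ := Nat.choose_succ_succ' (k + 6) (j + 3)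
    have h₃ := Nat.choose_succ_succ' (k + 6) (j + 2)
    have h₄ : (j + 5) * (k + 10 - (j + 5)) ≤ 2 * ((j + 4) * (k + 8 - (j + 4))) := by
      obtain ⟨l, hl⟩ : ∃ l, k = j + l := ⟨k - j, by omega⟩
      rw [show k + 10 - (j + 5) = l + 5 by omega, show k + 8 - (j + 4) = l + 4 by omega]
      nlinarith
    rw [show j + 2 + 1 = j + 3 by omega] at h₃
    rw [h₁, h₂]; rw [h₃] ; omega

theorem exists_card_lt_card_arcCodes {k m d f : ℕ} (hk : 5 ≤ k) (hm : m = k / 2) {ι : Type*}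
    {N : Finset ι} {P : ι → Finset (Fin k)} (hP : ∀ i ∈ N, (P i).card = m) (hN : 2 ≤ N.card)
    {S : Finset (Finset (Fin k))} (hS : S.card ≤ d + 1) (hNd : N.card + d ≤ m * (k - m))
    (hf : f + d + 2 ≤ m * (k - m)) :
    ∃ v ∈ N, ∃ w ∈ N, v ≠ w ∧
      f < (arcCodes (Finset.powersetCard m Finset.univ \ (N.image P ∪ S)) (P v) (P w)).card := by
  obtain ⟨v, hv, w, hw, hvw⟩ := Finset.one_lt_card.1 (show 1 < N.card by omega)
  set K := N.image P ∪ S with hK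
  set U := Finset.powersetCard m Finset.univ \ K with hU
  have hUm : ∀ Q ∈ U, Q.card = m := fun Q hQ =>
    (Finset.mem_powersetCard.1 (Finset.mem_sdiff.1 hQ).1).2
  have hUP : ∀ i ∈ N, P i ∉ U := fun i hi hPU =>
    (Finset.mem_sdiff.1 hPU).2 (Finset.mem_union_left _ (Finset.mem_image_of_mem P hi))
  have hKcard : K.card ≤ (N.image P).card + S.card := Finset.card_union_le _ _
  have himg : (N.image P).card ≤ N.card := Finset.card_image_le
  have hUcard : k.choose m ≤ U.card + K.card := by
    have := Finset.le_card_sdiff K (Finset.powersetCard m (Finset.univ : Finset (Fin k)))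
    rw [Finset.card_powersetCard, Finset.card_univ, Fintype.card_fin, ← hU] at this
    omega
  rcases Nat.lt_or_ge k 8 with hk8 | hk8
  · have hmin := min_le_card_arcCodes (hP v hv) (hP w hw) hUm (hUP v hv) (hUP w hw)
    rcases Nat.lt_or_ge 5 k with hk5 | hk5
    · refine ⟨v, hv, w, hw, hvw, lt_of_lt_of_le ?_ hmin⟩
      rw [hm] at hUcard hNd hf
      interval_cases k
      · rw [show Nat.choose 6 (6 / 2) = 20 by decide] at hUcard
        omega
      · rw [show Nat.choose 7 (7 / 2) = 35 by decide] at hUcard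
        omega
    obtain rfl : k = 5 := by omega
    obtain rfl : m = 2 := by omega
    rw [show Nat.choose 5 2 = 10 by decide] at hUcard
    by_cases hlarge : f < U.card
    · exact ⟨v, hv, w, hw, hvw, lt_of_lt_of_le (by omega) hmin⟩
    obtain ⟨Q, hQ, R, hR, hQR⟩ := Finset.one_lt_card.1 (show 1 < U.card by omega)
    have hnot := card_filter_not_disjoint_le Q (Finset.mem_sdiff.1 hQ).1 R
      (Finset.mem_sdiff.1 hR).1 hQR
    have hdisj : ∃ q ∈ N, ∃ T ∈ U, Disjoint (P q) T := by
      by_contra! hcon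
      have hsub : (N.image P).card ≤ 4 := by
        refine (Finset.card_le_card fun T hT => ?_).trans hnot
        obtain ⟨q, hq, rfl⟩ := Finset.mem_image.1 hT
        exact Finset.mem_filter.2 ⟨Finset.mem_powersetCard.2 ⟨Finset.subset_univ _, hP q hq⟩,
          fun h => hUP q hq (h ▸ hQ), fun h => hUP q hq (h ▸ hR), hcon q hq Q hQ, hcon q hq R hR⟩
      omega
    obtain ⟨q, hq, T, hT, hqT⟩ := hdisj
    obtain ⟨p, hp, hpq⟩ := Finset.exists_mem_ne (show 1 < N.card by omega) q
    refine ⟨p, hp, q, hq, hpq, lt_of_lt_of_le (show f < 5 by omega) ?_⟩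
    refine five_le_card_arcCodes (hP p hp) (hP q hq) hUm (hUP p hp) (hUP q hq) (by omega) hT ?_
    rw [Finset.sdiff_eq_self_of_disjoint hqT.symm, hUm T hT]
  · refine ⟨v, hv, w, hw, hvw, ?_⟩
    have hbinom := half_mul_sub_half_lt_choose k hk8
    rw [← hm] at hbinom
    have hmpos : 1 ≤ m := by omega
    have hsub : P v ×ˢ (P v)ᶜ ⊆ (arcCodes U (P v) (P w)).image Prod.fst := by
      rintro ⟨x, y⟩ hxy
      rw [Finset.mem_product, Finset.mem_compl] at hxy
      obtain ⟨hx, hy⟩ := hxy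
      dsimp only at hx hy
      have hyx : y ≠ x := fun h => hy (h ▸ hx)
      set L := (Finset.powersetCard (m - 1) ({x, y}ᶜ : Finset (Fin k))).image (insert y) with hL
      have hLcard : L.card = (k - 2).choose (m - 1) := by
        rw [hL, Finset.card_image_of_injOn, Finset.card_powersetCard, Finset.card_compl,
          Finset.card_pair hyx.symm, Fintype.card_fin]
        intro Q hQ R hR h
        have hn : ∀ T ∈ Finset.powersetCard (m - 1) ({x, y}ᶜ : Finset (Fin k)), y ∉ T :=
          fun T hT hyT => by
            have := (Finset.mem_powersetCard.1 hT).1 hyT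
            simp at this
        rw [← Finset.erase_insert (hn Q hQ), ← Finset.erase_insert (hn R hR)]
        exact congrArg (fun T => T.erase y) h
      have hLmem : ∀ Q ∈ L, y ∈ Q ∧ x ∉ Q ∧ Q.card = m := by
        intro Q hQ
        obtain ⟨T, hT, rfl⟩ := Finset.mem_image.1 hQ
        rw [Finset.mem_powersetCard] at hT
        have hyT : y ∉ T := fun h => by simpa using hT.1 h
        have hxT : x ∉ T := fun h => by simpa using hT.1 h
        refine ⟨Finset.mem_insert_self _ _, ?_, ?_⟩
        · rw [Finset.mem_insert]
          rintro (h | h)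
          exacts [hyx h.symm, hxT h]
        · rw [Finset.card_insert_of_notMem hyT, hT.2]
          omega
      have hex : ∃ Q ∈ L, Q ∉ K.erase (P v) := by
        refine Finset.exists_mem_notMem_of_card_lt_card ?_
        have hvK : P v ∈ K := Finset.mem_union_left _ (Finset.mem_image_of_mem P hv)
        rw [Finset.card_erase_of_mem hvK, hLcard]
        omega
      obtain ⟨Q, hQL, hQK⟩ := hex
      obtain ⟨hyQ, hxQ, hQm⟩ := hLmem Q hQL
      have hQU : Q ∈ U := Finset.mem_sdiff.2 ⟨Finset.mem_powersetCard.2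
        ⟨Finset.subset_univ _, hQm⟩, fun h => hQK (Finset.mem_erase.2
          ⟨fun h => hxQ (h ▸ hx), h⟩)⟩
      have hQw : Q ≠ P w := fun h => hUP w hw (h ▸ hQU)
      have hc := one_le_card_sdiff ((hP w hw).trans hQm.symm) hQw
      have hc' := card_sdiff_comm_of_card_eq ((hP w hw).trans hQm.symm)
      obtain ⟨z, hz⟩ := Finset.card_pos.1 hc
      obtain ⟨z', hz'⟩ := Finset.card_pos.1 (hc'.symm ▸ hc)
      refine Finset.mem_image.2 ⟨((x, y), (z', z)), ?_, rfl⟩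
      simp only [arcCodes, Finset.mem_biUnion, Finset.mem_product]
      exact ⟨Q, hQU, ⟨Finset.mem_sdiff.2 ⟨hx, hxQ⟩, Finset.mem_sdiff.2 ⟨hyQ, hy⟩⟩, hz', hz⟩
    have := (Finset.card_le_card hsub).trans Finset.card_image_le
    rw [Finset.card_product, Finset.card_compl, Fintype.card_fin, hP v hv] at this
    omega

theorem exists_mem_sdiff_pair {α : Type*} [DecidableEq α] {A Q : Finset α}
    (h : A.card = Q.card) (hne : Q ≠ A) : ∃ a : α × α, a.1 ∈ A \ Q ∧ a.2 ∈ Q \ A := by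
  have hc := one_le_card_sdiff h hne
  have hc' := card_sdiff_comm_of_card_eq h
  obtain ⟨z, hz⟩ := Finset.card_pos.1 hc
  obtain ⟨z', hz'⟩ := Finset.card_pos.1 (hc'.symm ▸ hc)
  exact ⟨(z', z), hz', hz⟩

/-- `A` with the element `a.1` replaced by `a.2`. -/
def swapFinset {α : Type*} [DecidableEq α] (A : Finset α) (a : α × α) : Finset α :=
  insert a.2 (A.erase a.1)

section swapFinset

variable {α : Type*} [DecidableEq α] {A : Finset α} {a : α × α}

theorem card_swapFinset (h₁ : a.1 ∈ A) (h₂ : a.2 ∉ A) : (swapFinset A a).card = A.card := by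
  rw [swapFinset, Finset.card_insert_of_notMem (fun h => h₂ (Finset.mem_of_mem_erase h)),
    Finset.card_erase_add_one h₁]

theorem sdiff_swapFinset (h₁ : a.1 ∈ A) (h₂ : a.2 ∉ A) : A \ swapFinset A a = {a.1} := by
  ext x
  simp only [swapFinset, Finset.mem_sdiff, Finset.mem_insert, Finset.mem_erase,
    Finset.mem_singleton]
  grind

theorem swapFinset_sdiff (h₂ : a.2 ∉ A) : swapFinset A a \ A = {a.2} := by
  ext x
  simp only [swapFinset, Finset.mem_sdiff, Finset.mem_insert, Finset.mem_erase,
    Finset.mem_singleton]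
  grind

theorem swapFinset_injOn [Fintype α] : Set.InjOn (swapFinset A) (A ×ˢ Aᶜ : Finset (α × α)) := by
  intro a ha b hb hab
  simp only [Finset.coe_product, Set.mem_prod, Finset.mem_coe, Finset.mem_compl] at ha hb
  have e₁ := sdiff_swapFinset ha.1 ha.2
  have e₂ := swapFinset_sdiff ha.2
  rw [hab, sdiff_swapFinset hb.1 hb.2, Finset.singleton_inj] at e₁
  rw [hab, swapFinset_sdiff hb.2, Finset.singleton_inj] at e₂
  exact Prod.ext e₁.symm e₂.symm

end swapFinset

theorem exists_code {k m d : ℕ} (hk : 5 ≤ k) (hm : m = k / 2) {ι β : Type*} [DecidableEq ι]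
    {N : Finset ι} {P : ι → Finset (Fin k)} (hP : ∀ i ∈ N, (P i).card = m) (hN : N.Nonempty)
    {S : Finset (Finset (Fin k))} (hS : S.card ≤ d + 1) (hNd : N.card + d ≤ m * (k - m))
    {F : Finset β} (hF : F.card + d + 2 ≤ m * (k - m)) (g : β → ι → Fin k × Fin k) :
    ∃ Q : Finset (Fin k), Q.card = m ∧ Q ∉ S ∧ (∀ i ∈ N, Q ≠ P i) ∧
      ∃ h : ι → Fin k × Fin k, (∀ i ∈ N, (h i).1 ∈ P i \ Q ∧ (h i).2 ∈ Q \ P i) ∧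
        ∀ b ∈ F, ∃ i ∈ N, h i ≠ g b i := by
  rcases (Nat.succ_le_of_lt hN.card_pos).lt_or_eq' with hN1 | hN1
  swap
  · obtain ⟨v, rfl⟩ := Finset.card_eq_one.1 hN1
    have hv := hP v (Finset.mem_singleton_self v)
    have hB : (((P v ×ˢ (P v)ᶜ).filter fun a => swapFinset (P v) a ∈ S) ∪
        F.image fun b => g b v).card < (P v ×ˢ (P v)ᶜ).card := by
      refine (Finset.card_union_le _ _).trans_lt ?_
      have h₁ : ((P v ×ˢ (P v)ᶜ).filter fun a => swapFinset (P v) a ∈ S).card ≤ S.card :=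
        Finset.card_le_card_of_injOn (swapFinset (P v)) (fun a ha => (Finset.mem_filter.1 ha).2)
          (swapFinset_injOn.mono (Finset.filter_subset _ _))
      have h₂ : (F.image fun b => g b v).card ≤ F.card := Finset.card_image_le
      rw [Finset.card_product, Finset.card_compl, Fintype.card_fin, hv]
      omega
    obtain ⟨a, ha, haB⟩ := Finset.exists_mem_notMem_of_card_lt_card hB
    rw [Finset.mem_union, not_or, Finset.mem_filter, not_and] at haB
    have haS := haB.1 ha
    rw [Finset.mem_product, Finset.mem_compl] at ha
    have hQ := card_swapFinset ha.1 ha.2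
    refine ⟨swapFinset (P v) a, hQ.trans hv, haS, ?_, fun _ => a, ?_, fun b hb => ?_⟩
    · intro i hi h
      rw [Finset.mem_singleton.1 hi] at h
      exact ha.2 (h ▸ Finset.mem_insert_self _ _)
    · intro i hi
      rw [Finset.mem_singleton.1 hi, sdiff_swapFinset ha.1 ha.2, swapFinset_sdiff ha.2]
      simp
    · exact ⟨v, Finset.mem_singleton_self v, fun h => haB.2 (Finset.mem_image.2 ⟨b, hb, h.symm⟩)⟩
  obtain ⟨v, hv, w, hw, hvw, hlt⟩ := exists_card_lt_card_arcCodes hk hm hP hN1 hS hNd hF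
  have : (F.image fun b => (g b v, g b w)).card ≤ F.card := Finset.card_image_le
  obtain ⟨p, hp, hpF⟩ := Finset.exists_mem_notMem_of_card_lt_card (this.trans_lt hlt)
  simp only [arcCodes, Finset.mem_biUnion, Finset.mem_product] at hp
  obtain ⟨Q, hQ, hpv, hpw⟩ := hp
  rw [Finset.mem_sdiff, Finset.mem_powersetCard, Finset.mem_union, not_or] at hQ
  obtain ⟨⟨-, hQm⟩, hQN, hQS⟩ := hQ
  have hQP : ∀ i ∈ N, Q ≠ P i := fun i hi h => hQN (h ▸ Finset.mem_image_of_mem P hi)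
  have hex : ∀ i, ∃ a : Fin k × Fin k, i ∈ N → a.1 ∈ P i \ Q ∧ a.2 ∈ Q \ P i := by
    intro i
    by_cases hi : i ∈ N
    · obtain ⟨a, ha⟩ := exists_mem_sdiff_pair ((hP i hi).trans hQm.symm) (hQP i hi)
      exact ⟨a, fun _ => ha⟩
    · exact ⟨p.1, fun h => absurd h hi⟩
  choose h₀ hh₀ using hex
  refine ⟨Q, hQm, hQS, hQP, Function.update (Function.update h₀ w p.2) v p.1, ?_, ?_⟩
  · intro i hi
    rcases eq_or_ne i v with rfl | hiv
    · simpa using hpv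
    rcases eq_or_ne i w with rfl | hiw
    · simpa [Function.update_of_ne hiv] using hpw
    · simpa [Function.update_of_ne hiv, Function.update_of_ne hiw] using hh₀ i hi
  · intro b hb
    by_contra! hcon
    have h₁ := hcon v hv
    have h₂ := hcon w hw
    rw [Function.update_self] at h₁
    rw [Function.update_of_ne hvw.symm, Function.update_self] at h₂
    exact hpF (Finset.mem_image.2 ⟨b, hb, by rw [← h₁, ← h₂]⟩)

/-- Choosing the values `f u` one after another, in the order of `rk`, where the constraint `C u`
on `f u` depends only on the values chosen before. -/
theorem exists_forall_of_greedy {V σ : Type*} [Finite V] [Nonempty σ] {rk : V → ℕ}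
    (hrk : Function.Injective rk) (C : V → σ → (V → σ) → Prop)
    (hloc : ∀ u s f g, (∀ w, rk w < rk u → f w = g w) → C u s f → C u s g)
    (hstep : ∀ u f, (∀ w, rk w < rk u → C w (f w) f) → ∃ s, C u s f) :
    ∃ f, ∀ u, C u (f u) f := by
  classical
  have main : ∀ n : ℕ, ∃ f, ∀ u, rk u < n → C u (f u) f := by
    intro n
    induction n with
    | zero => exact ⟨fun _ => Classical.arbitrary σ, fun u hu => absurd hu (Nat.not_lt_zero _)⟩
    | succ n ih =>
      obtain ⟨f, hf⟩ := ih
      by_cases hu : ∃ u, rk u = n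
      · obtain ⟨u, rfl⟩ := hu
        obtain ⟨s, hs⟩ := hstep u f hf
        have hupd : ∀ w, rk w < rk u → f w = Function.update f u s w := fun w hw =>
          (Function.update_of_ne (fun h => hw.ne (congrArg rk h)) s f).symm
        refine ⟨Function.update f u s, fun w hw => ?_⟩
        rcases Nat.lt_succ_iff_lt_or_eq.1 hw with hlt | heq
        · rw [← hupd w hlt]
          exact hloc w _ f _ (fun x hx => hupd x (hx.trans hlt)) (hf w hlt)
        · rw [hrk heq, Function.update_self]
          exact hloc u s f _ hupd hs
      · refine ⟨f, fun w hw => hf w ?_⟩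
        have : rk w ≠ n := fun h => hu ⟨w, h⟩
        omega
  obtain ⟨M, hM⟩ := (Set.finite_range rk).bddAbove
  obtain ⟨f, hf⟩ := main (M + 1)
  exact ⟨f, fun u => hf u (Nat.lt_succ_of_le (hM ⟨u, rfl⟩))⟩

theorem forall_eq_of_injective_rank {V : Type*} {rk : V → ℕ} (hrk : Function.Injective rk)
    {φ : V → V} (hφ : Function.Injective φ)
    (h : ∀ u, (∀ q, rk q < rk u → φ q = q) → ¬ rk u < rk (φ u)) : ∀ x, φ x = x := by
  have main : ∀ n x, rk x = n → φ x = x := by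
    intro n
    induction n using Nat.strong_induction_on with
    | _ n ih =>
      rintro u rfl
      have hfix : ∀ q, rk q < rk u → φ q = q := fun q hq => ih _ hq q rfl
      rcases lt_trichotomy (rk (φ u)) (rk u) with hlt | heq | hgt
      · exact hφ (hfix _ hlt)
      · exact hrk heq
      · exact absurd hgt (h u hfix)
  exact fun x => main _ x rfl

/-- The arc-colouring in which `h v u` lists the colours of the arcs `(u, v)` and `(v, u)`
whenever `u` precedes `v`. -/
def arcColour {V κ : Type*} (rk : V → ℕ) (h : V → V → κ × κ) (u v : V) : κ :=
  if rk u < rk v then (h v u).1 else (h u v).2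

theorem arcColour_of_lt {V κ : Type*} {rk : V → ℕ} {h : V → V → κ × κ} {u v : V}
    (huv : rk u < rk v) : arcColour rk h u v = (h v u).1 :=
  if_pos huv

theorem arcColour_of_gt {V κ : Type*} {rk : V → ℕ} {h : V → V → κ × κ} {u v : V}
    (huv : rk v < rk u) : arcColour rk h u v = (h u v).2 :=
  if_neg huv.not_gt

section Palette

variable {V : Type*} {G : SimpleGraph V} {k : ℕ}

/-- Every vertex `u` emits only colours of its palette `P u` and receives only other colours. -/
def IsPaletteColouring (G : SimpleGraph V) (P : V → Finset (Fin k)) (c : V → V → Fin k) : Prop :=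
  ∀ u v, G.Adj u v → c u v ∈ P u ∧ c u v ∉ P v

theorem isPaletteColouring_arcColour {rk : V → ℕ} (hrk : Function.Injective rk)
    {P : V → Finset (Fin k)} {h : V → V → Fin k × Fin k}
    (hh : ∀ u q, G.Adj q u → rk q < rk u → (h u q).1 ∈ P q \ P u ∧ (h u q).2 ∈ P u \ P q) :
    IsPaletteColouring G P (arcColour rk h) := by
  intro u v huv
  rcases lt_trichotomy (rk u) (rk v) with hlt | heq | hgt
  · rw [arcColour_of_lt hlt]
    exact Finset.mem_sdiff.1 (hh v u huv hlt).1
  · exact absurd (hrk heq) huv.ne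
  · rw [arcColour_of_gt hgt]
    exact Finset.mem_sdiff.1 (hh u v huv.symm hgt).2

theorem IsPaletteColouring.noMono2Path {P : V → Finset (Fin k)} {c : V → V → Fin k}
    (hc : IsPaletteColouring G P c) : NoMono2Path G c :=
  fun u v w huv hvw _ h => (hc u v huv).2 (h ▸ (hc v w hvw).1)

theorem IsPaletteColouring.not_adj_apply {P : V → Finset (Fin k)} {c : V → V → Fin k}
    (hc : IsPaletteColouring G P c) {φ : G ≃g G}
    (hφ : ∀ u v, G.Adj u v → c (φ u) (φ v) = c u v) (v : V) : ¬ G.Adj v (φ v) := by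
  intro hadj
  refine (hc _ _ hadj).2 ?_
  rw [← hφ _ _ hadj]
  exact (hc _ _ (φ.map_adj_iff.2 hadj)).1

theorem eq_of_arcColour_eq {rk : V → ℕ} {h : V → V → Fin k × Fin k} {φ : G ≃g G}
    (hφ : ∀ u v, G.Adj u v → arcColour rk h (φ u) (φ v) = arcColour rk h u v) {u q : V}
    (hqu : G.Adj q u) (hq : φ q = q) (h₁ : rk q < rk u) (h₂ : rk q < rk (φ u)) :
    h (φ u) q = h u q := by
  have e₁ := hφ q u hqu
  have e₂ := hφ u q hqu.symm
  rw [hq, arcColour_of_lt h₁, arcColour_of_lt h₂] at e₁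
  rw [hq, arcColour_of_gt h₁, arcColour_of_gt h₂] at e₂
  exact Prod.ext e₁ e₂

theorem adj_apply_iff_of_apply_eq (φ : G ≃g G) {q : V} (hq : φ q = q) (u : V) :
    G.Adj q (φ u) ↔ G.Adj q u := by
  conv_lhs => rw [← hq]
  exact φ.map_adj_iff

end Palette

theorem SimpleGraph.Iso.dist_apply {V : Type*} {G : SimpleGraph V} (hconn : G.Connected)
    (φ : G ≃g G) (u v : V) : G.dist (φ u) (φ v) = G.dist u v := by
  have hle : ∀ (ψ : G ≃g G) (x y : V), G.dist (ψ x) (ψ y) ≤ G.dist x y := by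
    intro ψ x y
    obtain ⟨p, hp⟩ := hconn.exists_walk_length_eq_dist x y
    rw [← hp, ← SimpleGraph.Walk.length_map ψ.toHom p]
    exact SimpleGraph.dist_le _
  refine le_antisymm (hle φ u v) ?_
  simpa using hle φ.symm (φ u) (φ v)

theorem SimpleGraph.Connected.exists_adj_dist_add_one {V : Type*} {G : SimpleGraph V}
    (hconn : G.Connected) {r u : V} (hne : u ≠ r) :
    ∃ q, G.Adj q u ∧ G.dist r q + 1 = G.dist r u := by
  obtain ⟨p, hp⟩ := hconn.exists_walk_length_eq_dist u r
  cases p with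
  | nil => exact absurd rfl hne
  | @cons _ q _ h p =>
    rw [SimpleGraph.Walk.length_cons] at hp
    have h₁ := SimpleGraph.dist_le p
    have h₂ := hconn.dist_triangle (u := r) (v := q) (w := u)
    rw [SimpleGraph.dist_eq_one_iff_adj.2 h.symm] at h₂
    rw [SimpleGraph.dist_comm] at hp h₁
    exact ⟨q, h.symm, by omega⟩

section Levels

variable {V : Type*} [Fintype V] (G : SimpleGraph V) [DecidableRel G.Adj]

/-- The neighbours of `u` that are closer to `r`. -/
noncomputable def parents (r u : V) : Finset V :=
  Finset.univ.filter fun q => G.Adj q u ∧ G.dist r q + 1 = G.dist r u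

/-- The neighbours of `u` with a smaller key. -/
noncomputable def lowerNbrs (key : V → ℕ) (u : V) : Finset V :=
  Finset.univ.filter fun q => G.Adj q u ∧ key q < key u

variable {G}

theorem mem_parents {r u q : V} : q ∈ parents G r u ↔ G.Adj q u ∧ G.dist r q + 1 = G.dist r u := by
  simp [parents]

theorem mem_lowerNbrs {key : V → ℕ} {u q : V} :
    q ∈ lowerNbrs G key u ↔ G.Adj q u ∧ key q < key u := by
  simp [lowerNbrs]

variable (G) in
theorem exists_level_order (r : V) :
    ∃ rk key : V → ℕ, Function.Injective rk ∧ (∀ u v, key u < key v → rk u < rk v) ∧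
      (∀ u v, G.dist r u < G.dist r v → key u < key v) ∧
      ∀ u v, key u = key v ↔ G.dist r u = G.dist r v ∧ parents G r u = parents G r v := by
  have lex : ∀ {n a b c d : ℕ}, b < n → a < c → a * n + b < c * n + d := by
    intro n a b c d hb hac
    nlinarith [Nat.mul_le_mul_right n (Nat.succ_le_of_lt hac)]
  have lex_eq : ∀ {n a b c d : ℕ}, b < n → d < n → a * n + b = c * n + d → a = c ∧ b = d := by
    intro n a b c d hb hd h
    have hac : a = c := by
      rcases lt_trichotomy a c with hlt | heq | hgt
      · exact absurd h (lex hb hlt).ne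
      · exact heq
      · exact absurd h (lex hd hgt).ne'
    subst hac
    exact ⟨rfl, by omega⟩
  let e := Fintype.equivFin (Finset V)
  let i := Fintype.equivFin V
  let key : V → ℕ := fun u => G.dist r u * Fintype.card (Finset V) + e (parents G r u)
  refine ⟨fun u => key u * Fintype.card V + i u, key, ?_, fun u v h => lex (i u).2 h,
    fun u v h => lex (e _).2 h, fun u v => ⟨fun h => ?_, fun h => ?_⟩⟩
  · intro u v h
    exact i.injective (Fin.ext (lex_eq (i u).2 (i v).2 h).2)
  · obtain ⟨h₁, h₂⟩ := lex_eq (e _).2 (e _).2 h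
    exact ⟨h₁, e.injective (Fin.ext h₂)⟩
  · simp only [key, h.1, h.2]

/-- The constraints on the palette `s.1` of `u` and on the colours `s.2 q` of the two arcs between
`u` and its earlier neighbours `q`, given these data for the earlier vertices. -/
structure IsLevelStep {k : ℕ} (G : SimpleGraph V) [DecidableRel G.Adj] (rk key : V → ℕ) (r : V)
    (A : Finset (Fin k)) (u : V)
    (s : Finset (Fin k) × (V → Fin k × Fin k)) (f : V → Finset (Fin k) × (V → Fin k × Fin k)) :
    Prop where
  card_eq : s.1.card = A.card
  eq_iff : s.1 = A ↔ u = r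
  ne : ∀ q, G.Adj q u → rk q < rk u → s.1 ≠ (f q).1
  mem : ∀ q, G.Adj q u → rk q < rk u → (s.2 q).1 ∈ (f q).1 \ s.1 ∧ (s.2 q).2 ∈ s.1 \ (f q).1
  eq_swap : G.Adj r u → s.1 = swapFinset A (s.2 r)
  root_ne : G.Adj r u → ∀ u', G.Adj r u' → rk u' < rk u → s.2 r ≠ (f u').2 r
  separated : ∀ u', key u' = key u → rk u' < rk u → ¬ G.Adj u' u →
    lowerNbrs G key u' = lowerNbrs G key u → ∃ q ∈ lowerNbrs G key u, s.2 q ≠ (f u').2 q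

theorem IsLevelStep.congr {k : ℕ} {rk key : V → ℕ} {r : V} {A : Finset (Fin k)} {u : V}
    {s : Finset (Fin k) × (V → Fin k × Fin k)} {f g : V → Finset (Fin k) × (V → Fin k × Fin k)}
    (hfg : ∀ w, rk w < rk u → f w = g w) (h : IsLevelStep G rk key r A u s f) :
    IsLevelStep G rk key r A u s g where
  card_eq := h.card_eq
  eq_iff := h.eq_iff
  ne q hq hlt := hfg q hlt ▸ h.ne q hq hlt
  mem q hq hlt := hfg q hlt ▸ h.mem q hq hlt
  eq_swap := h.eq_swap
  root_ne hu u' hu' hlt := hfg u' hlt ▸ h.root_ne hu u' hu' hlt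
  separated u' h₁ h₂ h₃ h₄ := hfg u' h₂ ▸ h.separated u' h₁ h₂ h₃ h₄

section Step

variable {k m : ℕ} {rk key : V → ℕ} {r u : V} {A : Finset (Fin k)}
  {f : V → Finset (Fin k) × (V → Fin k × Fin k)}

theorem exists_isLevelStep_root [NeZero k] (hconn : G.Connected) (hkey : ∀ u v, key u < key v → rk u < rk v)
    (hdist : ∀ u v, G.dist r u < G.dist r v → key u < key v) :
    ∃ s, IsLevelStep G rk key r A r s f := by
  have hno : ∀ q, ¬ rk q < rk r := by
    intro q hlt
    have hq : q ≠ r := fun h => hlt.ne (congrArg rk h)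
    have hpos := hconn.pos_dist_of_ne hq.symm
    have := hkey r q (hdist r q (by rwa [SimpleGraph.dist_self]))
    omega
  exact ⟨(A, fun _ => 0), rfl, by simp, fun q _ h => absurd h (hno q),
    fun q _ h => absurd h (hno q), fun h => absurd rfl h.ne, fun h => absurd rfl h.ne,
    fun u' _ h => absurd h (hno u')⟩

variable [DecidableEq V]

theorem exists_isLevelStep_of_adj (hdeg : G.degree r ≤ m * (k - m)) (hA : A.card = m)
    (hkey : ∀ u v, key u < key v → rk u < rk v)
    (hdist : ∀ u v, G.dist r u < G.dist r v → key u < key v)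
    (hf : ∀ w, rk w < rk u → IsLevelStep G rk key r A w (f w) f) (hu : G.Adj r u) :
    ∃ s, IsLevelStep G rk key r A u s f := by
  have hur : G.dist r u = 1 := SimpleGraph.dist_eq_one_iff_adj.2 hu
  set E := (G.neighborFinset r).filter fun w => rk w < rk u with hE
  have hlt : (E.image fun w => (f w).2 r).card < (A ×ˢ Aᶜ).card := by
    refine Finset.card_image_le.trans_lt ?_
    rw [Finset.card_product, Finset.card_compl, Fintype.card_fin, hA]
    refine lt_of_lt_of_le (Finset.card_lt_card ?_) hdeg
    refine Finset.filter_ssubset.2 ⟨u, by simpa using hu, lt_irrefl _⟩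
  obtain ⟨a, ha, haE⟩ := Finset.exists_mem_notMem_of_card_lt_card hlt
  have hnew : ∀ u', G.Adj r u' → rk u' < rk u → a ≠ (f u').2 r := fun u' h₁ h₂ h =>
    haE (Finset.mem_image.2 ⟨u', Finset.mem_filter.2 ⟨by simpa using h₁, h₂⟩, h.symm⟩)
  have ha' := ha
  rw [Finset.mem_product, Finset.mem_compl] at ha'
  have hQ := card_swapFinset ha'.1 ha'.2
  have hQA : swapFinset A a ≠ A := fun h => ha'.2 (h ▸ Finset.mem_insert_self _ _)
  have hrA : rk r < rk u → (f r).1 = A := fun h => (hf r h).eq_iff.2 rfl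
  have hne : ∀ q, G.Adj q u → rk q < rk u → swapFinset A a ≠ (f q).1 := by
    intro q hq hqu
    by_cases hqr : q = r
    · subst hqr
      rwa [hrA hqu]
    have hrq : G.Adj r q := by
      by_contra hn
      have h₁ := hkey u q (hdist u q ?_)
      · omega
      · have := SimpleGraph.Reachable.pos_dist_of_ne (hu.reachable.trans hq.symm.reachable)
          (Ne.symm hqr)
        have : G.dist r q ≠ 1 := fun h => hn (SimpleGraph.dist_eq_one_iff_adj.1 h)
        omega
    have hs := hf q hqu
    rw [hs.eq_swap hrq]
    have hrq' : rk r < rk q := hkey r q (hdist r q (by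
      rw [SimpleGraph.dist_self, SimpleGraph.dist_eq_one_iff_adj.2 hrq]; exact one_pos))
    have hb := hs.mem r hrq hrq'
    rw [hrA (hrq'.trans hqu)] at hb
    refine fun h => hnew q hrq hqu (swapFinset_injOn ha ?_ h)
    rw [Finset.mem_coe, Finset.mem_product, Finset.mem_compl]
    exact ⟨(Finset.mem_sdiff.1 hb.1).1, (Finset.mem_sdiff.1 hb.2).2⟩
  have hex : ∀ q, ∃ b : Fin k × Fin k, (G.Adj q u → rk q < rk u →
      b.1 ∈ (f q).1 \ swapFinset A a ∧ b.2 ∈ swapFinset A a \ (f q).1) ∧ (q = r → b = a) := by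
    intro q
    by_cases hqr : q = r
    · subst hqr
      refine ⟨a, fun _ hlt => ?_, fun _ => rfl⟩
      rw [hrA hlt, sdiff_swapFinset ha'.1 ha'.2, swapFinset_sdiff ha'.2]
      simp
    by_cases hq : G.Adj q u ∧ rk q < rk u
    · obtain ⟨b, hb⟩ := exists_mem_sdiff_pair
        ((hf q hq.2).card_eq.trans hQ.symm) (hne q hq.1 hq.2)
      exact ⟨b, fun _ _ => hb, fun h => absurd h hqr⟩
    · exact ⟨a, fun h₁ h₂ => absurd ⟨h₁, h₂⟩ hq, fun h => absurd h hqr⟩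
  choose h hh hr using hex
  have hrkey : ∀ w, G.Adj r w → r ∈ lowerNbrs G key w := fun w hw =>
    mem_lowerNbrs.2 ⟨hw, hdist r w (by
      rw [SimpleGraph.dist_self, SimpleGraph.dist_eq_one_iff_adj.2 hw]; exact one_pos)⟩
  refine ⟨(swapFinset A a, h), hQ, ⟨fun h => absurd h hQA, fun h => absurd h hu.ne'⟩, hne,
    hh, fun _ => by simp only [hr r rfl], fun _ u' h₁ h₂ => by
      simpa only [hr r rfl] using hnew u' h₁ h₂, fun u' _ h₂ _ h₄ => ⟨r, hrkey u hu, ?_⟩⟩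
  simpa only [hr r rfl] using hnew u' (mem_lowerNbrs.1 (h₄ ▸ hrkey u hu)).1 h₂

theorem exists_isLevelStep_of_not_adj (hconn : G.Connected) (hk : 5 ≤ k) (hm : m = k / 2)
    (hdeg : ∀ v, G.degree v ≤ m * (k - m)) (hA : A.card = m)
    (hkey : ∀ u v, key u < key v → rk u < rk v)
    (hdist : ∀ u v, G.dist r u < G.dist r v → key u < key v)
    (hclass : ∀ u v, key u = key v → G.dist r u = G.dist r v ∧ parents G r u = parents G r v)
    (hf : ∀ w, rk w < rk u → IsLevelStep G rk key r A w (f w) f) (hur : u ≠ r)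
    (hu : ¬ G.Adj r u) : ∃ s, IsLevelStep G rk key r A u s f := by
  set C := Finset.univ.filter fun w => key w = key u ∧ rk w < rk u with hC
  set D := C.filter fun w => G.Adj w u with hD
  set F := C.filter fun w => ¬ G.Adj w u with hF
  have hDmem : ∀ w, w ∈ D ↔ (key w = key u ∧ rk w < rk u) ∧ G.Adj w u := by simp [hD, hC]
  have hFmem : ∀ w, w ∈ F ↔ (key w = key u ∧ rk w < rk u) ∧ ¬ G.Adj w u := by simp [hF, hC]
  obtain ⟨v, hvu, hv⟩ := hconn.exists_adj_dist_add_one hur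
  have hvr : v ≠ r := by rintro rfl; exact hu hvu
  obtain ⟨z, hzv, hz⟩ := hconn.exists_adj_dist_add_one hvr
  have hcard₁ : (lowerNbrs G key u).card + D.card ≤ m * (k - m) := by
    rw [← Finset.card_union_of_disjoint]
    · refine (Finset.card_le_card ?_).trans (hdeg u)
      intro w hw
      rw [SimpleGraph.mem_neighborFinset]
      rw [Finset.mem_union, mem_lowerNbrs, hDmem] at hw
      rcases hw with hw | hw
      exacts [hw.1.symm, hw.2.symm]
    · rw [Finset.disjoint_left]
      intro w h₁ h₂
      rw [mem_lowerNbrs] at h₁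
      rw [hDmem] at h₂
      omega
  have hcard₂ : F.card + D.card + 2 ≤ m * (k - m) := by
    have hCcard : D.card + F.card = C.card := Finset.card_filter_add_card_filter_not _
    have huC : u ∉ C := by simp [hC]
    have hzC : z ∉ insert u C := by
      rw [Finset.mem_insert, not_or]
      refine ⟨fun h => ?_, fun h => ?_⟩
      · rw [h] at hz
        omega
      · have := (hclass z u (Finset.mem_filter.1 h).2.1).1
        omega
    have hle : (insert z (insert u C)).card ≤ G.degree v := by
      refine Finset.card_le_card ?_
      intro w hw
      rw [SimpleGraph.mem_neighborFinset]
      rw [Finset.mem_insert, Finset.mem_insert] at hw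
      rcases hw with rfl | rfl | hw
      · exact hzv.symm
      · exact hvu
      · have hp := (hclass w u (Finset.mem_filter.1 hw).2.1).2
        exact (mem_parents.1 (hp.symm ▸ mem_parents.2 ⟨hvu, hv⟩ : v ∈ parents G r w)).1
    rw [Finset.card_insert_of_notMem hzC, Finset.card_insert_of_notMem huC] at hle
    have := hdeg v
    omega
  have hlow : ∀ q ∈ lowerNbrs G key u, rk q < rk u := fun q hq =>
    hkey q u (mem_lowerNbrs.1 hq).2
  have hS : (insert A (D.image fun w => (f w).1)).card ≤ D.card + 1 :=
    (Finset.card_insert_le _ _).trans (Nat.add_le_add_right Finset.card_image_le 1)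
  obtain ⟨Q, hQ, hQS, hQN, h, hh, hsep⟩ := exists_code hk hm (N := lowerNbrs G key u)
    (P := fun q => (f q).1) (fun q hq => (hf q (hlow q hq)).card_eq.trans hA)
    ⟨v, mem_lowerNbrs.2 ⟨hvu, hdist v u (by omega)⟩⟩ hS hcard₁ hcard₂ (fun w => (f w).2)
  rw [Finset.mem_insert, not_or] at hQS
  have hsplit : ∀ q, G.Adj q u → rk q < rk u → q ∉ lowerNbrs G key u → q ∈ D := by
    intro q h₁ h₂ h₃
    rw [mem_lowerNbrs, not_and] at h₃
    have h₄ := h₃ h₁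
    have h₅ : ¬ key u < key q := fun h => by
      have := hkey u q h
      omega
    exact (hDmem q).2 ⟨⟨by omega, h₂⟩, h₁⟩
  have hne : ∀ q, G.Adj q u → rk q < rk u → Q ≠ (f q).1 := by
    intro q h₁ h₂
    by_cases hq : q ∈ lowerNbrs G key u
    · exact hQN q hq
    · exact fun h => hQS.2 (Finset.mem_image.2 ⟨q, hsplit q h₁ h₂ hq, h.symm⟩)
  have hex : ∀ q, ∃ b : Fin k × Fin k, (G.Adj q u → rk q < rk u →
      b.1 ∈ (f q).1 \ Q ∧ b.2 ∈ Q \ (f q).1) ∧ (q ∈ lowerNbrs G key u → b = h q) := by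
    intro q
    by_cases hq : q ∈ lowerNbrs G key u
    · exact ⟨h q, fun _ _ => hh q hq, fun _ => rfl⟩
    by_cases hqu : G.Adj q u ∧ rk q < rk u
    · obtain ⟨b, hb⟩ := exists_mem_sdiff_pair
        (((hf q hqu.2).card_eq.trans hA).trans hQ.symm) (hne q hqu.1 hqu.2)
      exact ⟨b, fun _ _ => hb, fun h => absurd h hq⟩
    · exact ⟨h q, fun h₁ h₂ => absurd ⟨h₁, h₂⟩ hqu, fun _ => rfl⟩
  choose h' hh' hh'' using hex
  refine ⟨(Q, h'), hQ.trans hA.symm, ⟨fun h => absurd h hQS.1, fun h => absurd h hur⟩, hne, hh',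
    fun h => absurd h hu, fun h => absurd h hu, fun u' h₁ h₂ h₃ _ => ?_⟩
  obtain ⟨q, hq, hne⟩ := hsep u' ((hFmem u').2 ⟨⟨h₁, h₂⟩, h₃⟩)
  exact ⟨q, hq, (hh'' q hq).trans_ne hne⟩

end Step

theorem exists_colouring_of_five_le [DecidableEq V] (hconn : G.Connected) {k m : ℕ} (hk : 5 ≤ k)
    (hm : m = k / 2) (hle : G.maxDegree ≤ m * (k - m)) (hlt : (m - 1) * (k - m) < G.maxDegree) :
    ∃ c : V → V → Fin k, NoMono2Path G c ∧ IsDistinguishing G c := by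
  have : NeZero k := ⟨by omega⟩
  have := hconn.nonempty
  obtain ⟨r, hr⟩ := G.exists_maximal_degree_vertex
  obtain ⟨rk, key, hrk, hkey, hdist, hclass⟩ := exists_level_order G r
  obtain ⟨A, -, hA⟩ := Finset.exists_subset_card_eq
    (show m ≤ (Finset.univ : Finset (Fin k)).card by rw [Finset.card_univ, Fintype.card_fin]; omega)
  have hdeg : ∀ v, G.degree v ≤ m * (k - m) := fun v => (G.degree_le_maxDegree v).trans hle
  obtain ⟨f, hf⟩ := exists_forall_of_greedy hrk (IsLevelStep G rk key r A)
    (fun u s f g hfg h => h.congr hfg) (fun u f hf => by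
      by_cases hur : u = r
      · subst hur
        exact exists_isLevelStep_root hconn hkey hdist
      by_cases hu : G.Adj r u
      · exact exists_isLevelStep_of_adj (hdeg r) hA hkey hdist hf hu
      · exact exists_isLevelStep_of_not_adj hconn hk hm hdeg hA hkey hdist
          (fun u v => (hclass u v).1) hf hur hu)
  set c := arcColour rk fun u => (f u).2 with hcdef
  have hc : IsPaletteColouring G (fun u => (f u).1) c :=
    isPaletteColouring_arcColour hrk fun u => (hf u).mem
  refine ⟨c, hc.noMono2Path, fun φ hφ => ?_⟩
  have hrA : (f r).1 = A := (hf r).eq_iff.2 rfl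
  have hroot : ∀ u, G.Adj r u → rk r < rk u := fun u hu => hkey r u (hdist r u (by
    rw [SimpleGraph.dist_self, SimpleGraph.dist_eq_one_iff_adj.2 hu]; exact one_pos))
  have hφr : φ r = r := by
    refine (hf (φ r)).eq_iff.1 (Finset.eq_of_subset_of_card_le ?_ (hf (φ r)).card_eq.le).symm
    intro x hx
    have hex : ∃ u, G.Adj r u ∧ ((f u).2 r).1 = x := by
      by_contra! hcon
      have hinj : Set.InjOn (fun u => (f u).2 r) (G.neighborFinset r) := by
        intro u hu v hv huv
        rw [Finset.mem_coe, SimpleGraph.mem_neighborFinset] at hu hv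
        by_contra hne
        rcases Nat.lt_or_gt_of_ne (hrk.ne hne) with h | h
        · exact (hf v).root_ne hv u hu h huv.symm
        · exact (hf u).root_ne hu v hv h huv
      have hcard : (G.neighborFinset r).card ≤ (A.erase x ×ˢ Aᶜ).card := by
        refine Finset.card_le_card_of_injOn _ ?_ hinj
        intro u hu
        rw [Finset.mem_coe, SimpleGraph.mem_neighborFinset] at hu
        have hmem := (hf u).mem r hu (hroot u hu)
        rw [hrA] at hmem
        rw [Finset.mem_coe, Finset.mem_product, Finset.mem_compl, Finset.mem_erase]
        exact ⟨⟨hcon u hu, (Finset.mem_sdiff.1 hmem.1).1⟩, (Finset.mem_sdiff.1 hmem.2).2⟩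
      rw [Finset.card_product, Finset.card_erase_of_mem hx, Finset.card_compl, Fintype.card_fin,
        hA, SimpleGraph.card_neighborFinset_eq_degree] at hcard
      omega
    obtain ⟨u, hu, rfl⟩ := hex
    have h := hφ r u hu
    rw [hcdef, arcColour_of_lt (hroot u hu), ← hcdef] at h
    rw [← h]
    exact (hc _ _ (φ.map_adj_iff.2 hu)).1
  refine forall_eq_of_injective_rank hrk φ.injective fun u hfix hu => ?_
  have hadj : ∀ q, rk q < rk u → (G.Adj q (φ u) ↔ G.Adj q u) := fun q hq =>
    adj_apply_iff_of_apply_eq φ (hfix q hq) u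
  have hd : G.dist r (φ u) = G.dist r u := by
    conv_lhs => rw [← hφr]
    exact SimpleGraph.Iso.dist_apply hconn φ r u
  have hkeq : key u = key (φ u) := by
    refine (hclass _ _).2 ⟨hd.symm, Finset.ext fun q => ?_⟩
    rw [mem_parents, mem_parents, hd]
    exact and_congr_left fun hq => (hadj q (hkey q u (hdist q u (by omega)))).symm
  have hN : lowerNbrs G key u = lowerNbrs G key (φ u) := by
    ext q
    rw [mem_lowerNbrs, mem_lowerNbrs, ← hkeq]
    exact and_congr_left fun hq => (hadj q (hkey q u hq)).symm
  obtain ⟨q, hq, hne⟩ := (hf (φ u)).separated u hkeq hu (hc.not_adj_apply hφ u) hN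
  rw [← hN, mem_lowerNbrs] at hq
  have hqu := hkey q u hq.2
  exact hne (eq_of_arcColour_eq (h := fun u => (f u).2) hφ hq.1 (hfix q hqu) hqu (hqu.trans hu))

end Levels

theorem SimpleGraph.Connected.exists_adj_mem_notMem {V : Type*} {G : SimpleGraph V}
    (hconn : G.Connected) {S : Set V} {a b : V} (ha : a ∈ S) (hb : b ∉ S) :
    ∃ x y, x ∈ S ∧ y ∉ S ∧ G.Adj x y := by
  obtain ⟨p⟩ := hconn a b
  obtain ⟨d, -, h₁, h₂⟩ := p.exists_boundary_dart S ha hb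
  exact ⟨d.fst, d.snd, h₁, h₂, d.adj⟩

/-- `rk` numbers the vertices visited so far by `0, …, n - 1`; every vertex but the first is visited
after one of its neighbours, and immediately after a vertex with unvisited neighbours one of these
is visited. -/
structure IsPartialSearch {V : Type*} (G : SimpleGraph V) (rk : V → ℕ) (n : ℕ) : Prop where
  inj : ∀ u v, rk u < n → rk u = rk v → u = v
  surj : ∀ i < n, ∃ v, rk v = i
  exists_adj : ∀ u, rk u < n → 0 < rk u → ∃ q, G.Adj q u ∧ rk q < rk u
  adj_succ : ∀ v w, rk w < n → rk w = rk v + 1 → G.Adj v w ∨ ∀ x, G.Adj v x → rk x ≤ rk v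

namespace IsPartialSearch

variable {V : Type*} {G : SimpleGraph V} {rk : V → ℕ} {n : ℕ}

theorem exists_snoc (h : IsPartialSearch G rk n) {u : V} (hu : n ≤ rk u)
    (hadj : ∃ q, G.Adj q u ∧ rk q < n)
    (hlast : ∀ v, rk v + 1 = n → G.Adj v u ∨ ∀ x, G.Adj v x → rk x < n) :
    ∃ rk', IsPartialSearch G rk' (n + 1) ∧ (∀ v, rk v < n → rk' v = rk v) ∧ rk' u = n ∧
      ∀ v, v ≠ u → n ≤ rk v → n < rk' v := by
  classical
  obtain ⟨rk', hrk'⟩ : ∃ rk' : V → ℕ, ∀ v, rk' v =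
    if rk v < n then rk v else if v = u then n else n + 1 := ⟨_, fun _ => rfl⟩
  have hold : ∀ v, rk v < n → rk' v = rk v := fun v hv => by rw [hrk', if_pos hv]
  have hself : rk' u = n := by rw [hrk', if_neg hu.not_gt, if_pos rfl]
  have hnew : ∀ v, v ≠ u → n ≤ rk v → rk' v = n + 1 := fun v hv hn => by
    rw [hrk', if_neg hn.not_gt, if_neg hv]
  have hcases : ∀ v, (rk v < n ∧ rk' v = rk v) ∨ (v = u ∧ rk' v = n) ∨ n ≤ rk v ∧ rk' v = n + 1 := by
    intro v
    by_cases h₁ : rk v < n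
    · exact Or.inl ⟨h₁, hold v h₁⟩
    · by_cases h₂ : v = u
      · exact Or.inr (Or.inl ⟨h₂, h₂ ▸ hself⟩)
      · exact Or.inr (Or.inr ⟨not_lt.1 h₁, hnew v h₂ (not_lt.1 h₁)⟩)
  refine ⟨rk', ⟨fun a b ha hab => ?_, fun i hi => ?_, fun a ha h0 => ?_, fun v w hw hvw => ?_⟩,
    hold, hself, fun v hv hn => by rw [hnew v hv hn]; exact Nat.lt_succ_self n⟩
  · rcases hcases a with ⟨h₁, h₂⟩ | ⟨h₁, h₂⟩ | ⟨h₁, h₂⟩ <;>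
    rcases hcases b with ⟨h₃, h₄⟩ | ⟨h₃, h₄⟩ | ⟨h₃, h₄⟩ <;> try omega
    · exact h.inj a b h₁ (by omega)
    · rw [h₁, h₃]
  · rcases Nat.lt_succ_iff_lt_or_eq.1 hi with hi | rfl
    · obtain ⟨v, rfl⟩ := h.surj i hi
      exact ⟨v, hold v hi⟩
    · exact ⟨u, hself⟩
  · rcases hcases a with ⟨h₁, h₂⟩ | ⟨h₁, h₂⟩ | ⟨h₁, h₂⟩
    · obtain ⟨q, hq, hlt⟩ := h.exists_adj a h₁ (by omega)
      exact ⟨q, hq, by rw [hold q (hlt.trans h₁)]; omega⟩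
    · obtain ⟨q, hq, hlt⟩ := hadj
      exact ⟨q, h₁ ▸ hq, by rw [hold q hlt]; omega⟩
    · omega
  · have hle : ∀ x, rk x ≤ rk v → rk v < n → rk' x ≤ rk' v := fun x hx hv => by
      rw [hold v hv, hold x (hx.trans_lt hv)]
      exact hx
    rcases hcases v with ⟨h₁, h₂⟩ | ⟨h₁, h₂⟩ | ⟨h₁, h₂⟩
    · rcases hcases w with ⟨h₃, h₄⟩ | ⟨h₃, h₄⟩ | ⟨h₃, h₄⟩
      · exact (h.adj_succ v w h₃ (by omega)).imp_right fun hx x hvx => hle x (hx x hvx) h₁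
      · rw [h₃]
        refine (hlast v (by omega)).imp_right fun hx x hvx => hle x ?_ h₁
        have := hx x hvx
        omega
      · omega
    · omega
    · omega

theorem exists_extend [Finite V] (hconn : G.Connected) (h : IsPartialSearch G rk n) (hn : 0 < n) :
    ∃ rk' N, IsPartialSearch G rk' N ∧ (∀ v, rk' v < N) ∧ ∀ v, rk v < n → rk' v = rk v := by
  have main : ∀ (d n : ℕ) (rk : V → ℕ), {v | n ≤ rk v}.ncard = d → IsPartialSearch G rk n → 0 < n →
      ∃ rk' N, IsPartialSearch G rk' N ∧ (∀ v, rk' v < N) ∧ ∀ v, rk v < n → rk' v = rk v := by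
    intro d
    induction d using Nat.strong_induction_on with
    | _ d ih =>
      rintro n rk rfl h hn
      by_cases hall : ∀ v, rk v < n
      · exact ⟨rk, n, h, hall, fun _ _ => rfl⟩
      push Not at hall
      obtain ⟨b, hb⟩ := hall
      obtain ⟨l, hl⟩ := h.surj (n - 1) (by omega)
      have hex : ∃ u, n ≤ rk u ∧ (∃ q, G.Adj q u ∧ rk q < n) ∧
          ∀ v, rk v + 1 = n → G.Adj v u ∨ ∀ x, G.Adj v x → rk x < n := by
        have hlv : ∀ v, rk v + 1 = n → v = l := fun v hv => h.inj v l (by omega) (by omega)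
        by_cases hx : ∃ x, G.Adj l x ∧ n ≤ rk x
        · obtain ⟨x, hlx, hx⟩ := hx
          exact ⟨x, hx, ⟨l, hlx, by omega⟩, fun v hv => Or.inl (hlv v hv ▸ hlx)⟩
        · push Not at hx
          obtain ⟨x, y, h₁, h₂, hxy⟩ := hconn.exists_adj_mem_notMem (S := {v | rk v < n})
            (show l ∈ _ by rw [Set.mem_ofPred_eq]; omega) (show b ∉ _ from not_lt.2 hb)
          exact ⟨y, not_lt.1 h₂, ⟨x, hxy, h₁⟩, fun v hv => Or.inr (hlv v hv ▸ hx)⟩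
      obtain ⟨u, hu, hadj, hlast⟩ := hex
      obtain ⟨rk₁, h₁, hold, hself, hnew⟩ := h.exists_snoc hu hadj hlast
      have hlt : {v | n + 1 ≤ rk₁ v}.ncard < {v | n ≤ rk v}.ncard := by
        refine Set.ncard_lt_ncard ⟨fun v hv => ?_, fun hsub => ?_⟩
        · by_contra hv'
          rw [Set.mem_ofPred_eq, not_le] at hv'
          rw [Set.mem_ofPred_eq, hold v hv'] at hv
          omega
        · have := hsub (show u ∈ {v | n ≤ rk v} from hu)
          rw [Set.mem_ofPred_eq, hself] at this
          omega
      obtain ⟨rk', N, h', hN, heq⟩ := ih _ hlt (n + 1) rk₁ rfl h₁ (Nat.succ_pos n)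
      refine ⟨rk', N, h', hN, fun v hv => ?_⟩
      rw [heq v (by rw [hold v hv]; omega), hold v hv]
  exact main _ n rk rfl h hn

end IsPartialSearch

/-- A search order starting with the adjacent vertices `r` and `s`. -/
structure IsSearchOrder {V : Type*} (G : SimpleGraph V) (rk : V → ℕ) (r s : V) : Prop where
  injective : Function.Injective rk
  root : rk r = 0
  second : rk s = 1
  adj : G.Adj r s
  exists_adj : ∀ u, u ≠ r → ∃ q, G.Adj q u ∧ rk q < rk u
  adj_succ : ∀ v u, G.Adj v u → rk v < rk u → ∃ w, rk w = rk v + 1 ∧ G.Adj v w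

theorem IsPartialSearch.isSearchOrder {V : Type*} {G : SimpleGraph V} {rk : V → ℕ} {n : ℕ}
    (h : IsPartialSearch G rk n) (hn : ∀ v, rk v < n) {r s : V} (hr : rk r = 0) (hs : rk s = 1)
    (hrs : G.Adj r s) : IsSearchOrder G rk r s where
  injective u v huv := h.inj u v (hn u) huv
  root := hr
  second := hs
  adj := hrs
  exists_adj u hu := h.exists_adj u (hn u) (Nat.pos_of_ne_zero fun h0 =>
    hu (h.inj u r (hn u) (h0.trans hr.symm)))
  adj_succ v u hvu hlt := by
    obtain ⟨w, hw⟩ := h.surj (rk v + 1) (lt_of_le_of_lt hlt (hn u))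
    refine ⟨w, hw, (h.adj_succ v w (hn w) hw).resolve_right fun hx => ?_⟩
    have := hx u hvu
    omega

/-- Either `r` dominates the graph, or the search goes on with a vertex at distance two from `r`
and, if some vertex at distance two has two common neighbours with `r`, with a further neighbour
of `r`. -/
theorem exists_isSearchOrder {V : Type*} [Finite V] {G : SimpleGraph V} (hconn : G.Connected)
    {r : V} (hr : ∃ s, G.Adj r s) :
    ∃ rk s, IsSearchOrder G rk r s ∧ ((∀ v, v ≠ r → G.Adj r v) ∨
      ∃ t, rk t = 2 ∧ G.Adj s t ∧ t ≠ r ∧ ¬ G.Adj r t ∧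
        ((∀ w a b, w ≠ r → ¬ G.Adj r w → G.Adj r a → G.Adj r b → G.Adj w a → G.Adj w b → a = b) ∨
          ∃ t', rk t' = 3 ∧ G.Adj r t' ∧ G.Adj t t')) := by
  classical
  have hroot : IsPartialSearch G (fun v => if v = r then 0 else 1) 1 := by
    refine ⟨fun u v hu huv => ?_, fun i hi => ⟨r, by rw [if_pos rfl]; omega⟩,
      fun u hu h0 => by omega, fun v w hw hvw => by omega⟩
    split_ifs at hu huv with h₁ h₂
    · rw [h₁, h₂]
    · omega
  have hsnd : ∀ s, G.Adj r s → ∃ rk, IsPartialSearch G rk 2 ∧ rk r = 0 ∧ rk s = 1 ∧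
      ∀ v, v ≠ r → v ≠ s → 2 ≤ rk v := by
    intro s hrs
    obtain ⟨rk, h, hold, hself, hnew⟩ := hroot.exists_snoc (u := s)
      (by rw [if_neg hrs.ne']) ⟨r, hrs, by simp⟩ (fun v hv => Or.inl (by
        by_cases hvr : v = r
        · rwa [hvr]
        · rw [if_neg hvr] at hv
          omega))
    refine ⟨rk, h, by rw [hold r (by simp)]; simp, hself, fun v h₁ h₂ => hnew v h₂ ?_⟩
    rw [if_neg h₁]
  have hthird : ∀ s t, G.Adj r s → G.Adj s t → t ≠ r → ∃ rk, IsPartialSearch G rk 3 ∧ rk r = 0 ∧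
      rk s = 1 ∧ rk t = 2 ∧ ∀ v, v ≠ r → v ≠ s → v ≠ t → 3 ≤ rk v := by
    intro s t hrs hst htr
    obtain ⟨rk, h, hr0, hs1, hge⟩ := hsnd s hrs
    obtain ⟨rk', h', hold, hself, hnew⟩ := h.exists_snoc (u := t) (hge t htr hst.ne')
      ⟨s, hst, by omega⟩ (fun v hv => Or.inl (by
        rwa [h.inj v s (by omega) (by omega)]))
    exact ⟨rk', h', by rw [hold r (by omega), hr0], by rw [hold s (by omega), hs1], hself,
      fun v h₁ h₂ h₃ => hnew v h₃ (hge v h₁ h₂)⟩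
  by_cases hdom : ∀ v, v ≠ r → G.Adj r v
  · obtain ⟨s, hrs⟩ := hr
    obtain ⟨rk, h, hr0, hs1, -⟩ := hsnd s hrs
    obtain ⟨rk', N, h', hN, heq⟩ := h.exists_extend hconn two_pos
    exact ⟨rk', s, h'.isSearchOrder hN (by rw [heq r (by omega), hr0])
      (by rw [heq s (by omega), hs1]) hrs, Or.inl hdom⟩
  by_cases hdouble : ∀ w a b, w ≠ r → ¬ G.Adj r w → G.Adj r a → G.Adj r b → G.Adj w a →
      G.Adj w b → a = b
  · push Not at hdom
    obtain ⟨b, hbr, hb⟩ := hdom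
    obtain ⟨s, t, h₁, h₂, hst⟩ := hconn.exists_adj_mem_notMem (S := {v | v = r ∨ G.Adj r v})
      (show r ∈ _ from Or.inl rfl) (show b ∉ _ from not_or.2 ⟨hbr, hb⟩)
    rw [Set.mem_ofPred_eq, not_or] at h₂
    have hrs : G.Adj r s := h₁.resolve_left fun h => h₂.2 (h ▸ hst)
    obtain ⟨rk, h, hr0, hs1, ht2, -⟩ := hthird s t hrs hst h₂.1
    obtain ⟨rk', N, h', hN, heq⟩ := h.exists_extend hconn three_pos
    exact ⟨rk', s, h'.isSearchOrder hN (by rw [heq r (by omega), hr0])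
      (by rw [heq s (by omega), hs1]) hrs, Or.inr ⟨t, by rw [heq t (by omega), ht2], hst, h₂.1,
        h₂.2, Or.inl hdouble⟩⟩
  · push Not at hdouble
    obtain ⟨t, s, t', htr, hrt, hrs, hrt', hts, htt', hne⟩ := hdouble
    obtain ⟨rk, h, hr0, hs1, ht2, hge⟩ := hthird s t hrs hts.symm htr
    obtain ⟨rk₁, h₁, hold, hself, -⟩ := h.exists_snoc (u := t')
      (hge t' hrt'.ne' hne.symm htt'.ne') ⟨t, htt', by omega⟩ (fun v hv => Or.inl (by
        rwa [h.inj v t (by omega) (by omega)]))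
    obtain ⟨rk', N, h', hN, heq⟩ := h₁.exists_extend hconn four_pos
    have hold' : ∀ v, rk v < 3 → rk' v = rk v := fun v hv => by
      rw [heq v (by rw [hold v hv]; omega), hold v hv]
    exact ⟨rk', s, h'.isSearchOrder hN (by rw [hold' r (by omega), hr0])
      (by rw [hold' s (by omega), hs1]) hrs, Or.inr ⟨t, by rw [hold' t (by omega), ht2], hts.symm,
        htr, hrt, Or.inr ⟨t', by rw [heq t' (by omega), hself], hrt', htt'⟩⟩⟩

section FourColours

/-- The one pair among `(0, 2)` and `(2, 0)` that can join a vertex with palette `P` to a vertex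
with the complementary palette. -/
def markerPair (P : Finset (Fin 4)) : Fin 4 × Fin 4 :=
  if 0 ∈ P then (0, 2) else (2, 0)

theorem eq_markerPair {P : Finset (Fin 4)} {a : Fin 4 × Fin 4} (h₁ : a.1 ∈ P) (h₂ : a.2 ∉ P)
    (ha : a = (0, 2) ∨ a = (2, 0)) : a = markerPair P := by
  rcases ha with rfl | rfl
  · rw [markerPair, if_pos h₁]
  · rw [markerPair, if_neg h₂]

theorem exists_pair_ne_marker : ∀ P Q : Finset (Fin 4), P.card = 2 → Q.card = 2 → Q ≠ P →
    ∃ a : Fin 4 × Fin 4, (a.1 ∈ P \ Q ∧ a.2 ∈ Q \ P) ∧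
      (Q = Pᶜ → a ≠ (0, 2) ∧ a ≠ (2, 0)) := by
  set_option maxRecDepth 100000 in decide

theorem card_mixed_palettes : ∀ P : Finset (Fin 4), P.card = 2 →
    ((Finset.powersetCard 2 (Finset.univ : Finset (Fin 4))).filter
      fun T => T ≠ P ∧ T ≠ Pᶜ).card = 4 := by
  set_option maxRecDepth 100000 in decide

theorem eq_zero_three : ∀ P Q : Finset (Fin 4), P.card = 2 ∧ Q.card = 2 ∧ Q ≠ Pᶜ →
    (0 ∈ P ∧ 0 ∉ Q) ∧ (2 ∈ Q ∧ 2 ∉ P) → 3 ∈ Q → P = {0, 3} := by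
  set_option maxRecDepth 100000 in decide

theorem eq_one_two_or_two_three : ∀ P : Finset (Fin 4), P.card = 2 → 2 ∈ P → 0 ∉ P →
    P = {1, 2} ∨ P = {0, 1}ᶜ := by
  set_option maxRecDepth 100000 in decide

theorem eq_of_common_pair {α : Type*} [DecidableEq α] [Fintype α] {P Q R : Finset α} {x y : α}
    (hQ : Q.card = 2) (hR : R.card = 2) (hxP : x ∉ P) (hyP : y ∉ Pᶜ) (hxQ : x ∈ Q) (hyQ : y ∈ Q)
    (hxR : x ∈ R) (hyR : y ∈ R) : Q = R := by
  have hxy : x ≠ y := fun h => hyP (h ▸ Finset.mem_compl.2 hxP)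
  have hpair : ∀ S : Finset α, S.card = 2 → x ∈ S → y ∈ S → {x, y} = S := fun S hS hx hy =>
    Finset.eq_of_subset_of_card_le (Finset.insert_subset hx (Finset.singleton_subset_iff.2 hy))
      (by rw [hS, Finset.card_pair hxy])
  rw [← hpair Q hQ hxQ hyQ, hpair R hR hxR hyR]

variable {V : Type*}

/-- `par u` is the first visited neighbour of `u`. -/
def IsFirstNbr (G : SimpleGraph V) (rk : V → ℕ) (r : V) (par : V → V) : Prop :=
  ∀ u, u ≠ r → G.Adj (par u) u ∧ rk (par u) < rk u ∧ ∀ q, G.Adj q u → rk (par u) ≤ rk q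

/-- The constraints on the palette `t.1` of `u` and on the colours `t.2 q` of the two arcs between
`u` and its earlier neighbours `q`, given these data for the earlier vertices. -/
structure IsFourStep (G : SimpleGraph V) (rk : V → ℕ) (par : V → V) (r s u : V)
    (t : Finset (Fin 4) × (V → Fin 4 × Fin 4))
    (f : V → Finset (Fin 4) × (V → Fin 4 × Fin 4)) : Prop where
  card_eq : t.1.card = 2
  root : u = r → t.1 = {0, 1}
  ne : ∀ q, G.Adj q u → rk q < rk u → t.1 ≠ (f q).1
  mem : ∀ q, G.Adj q u → rk q < rk u → (t.2 q).1 ∈ (f q).1 \ t.1 ∧ (t.2 q).2 ∈ t.1 \ (f q).1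
  marker : ∀ q, G.Adj q u → rk q < rk u → ¬ (u = s ∧ q = r) → t.1 = (f q).1ᶜ →
    t.2 q ≠ (0, 2) ∧ t.2 q ≠ (2, 0)
  second : u = s → t.1 = {2, 3} ∧ t.2 r = (0, 2)
  third : rk u = 2 → ¬ G.Adj r u → t.1 = {0, 1} ∧ t.2 s = (3, 1)
  next_nbr : G.Adj r u → u ≠ s → (∀ q, G.Adj r q → rk q < rk u → q = s) → t.1 ≠ {1, 2}
  compl : u ≠ r → (∀ w, G.Adj w u → rk w < rk u → (f w).1 ≠ (f (par u)).1ᶜ) →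
    t.1 = (f (par u)).1ᶜ ∧ ∀ u', u' ≠ r → rk u' < rk u → par u' = par u →
      t.2 (par u) ≠ (f u').2 (par u)
  twin : u ≠ r → ∀ u', u' ≠ r → rk u' < rk u → ¬ G.Adj u' u → par u' = par u →
    (∃ w, rk w < rk u' ∧ G.Adj w u' ∧ G.Adj w u ∧ (f w).1 = (f (par u)).1ᶜ) → t.1 ≠ (f u').1

variable {G : SimpleGraph V} {rk : V → ℕ} {par : V → V} {r s u : V}
  {t : Finset (Fin 4) × (V → Fin 4 × Fin 4)} {f g : V → Finset (Fin 4) × (V → Fin 4 × Fin 4)}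

theorem IsFourStep.congr (hpar : IsFirstNbr G rk r par) (hfg : ∀ w, rk w < rk u → f w = g w)
    (h : IsFourStep G rk par r s u t f) : IsFourStep G rk par r s u t g where
  card_eq := h.card_eq
  root := h.root
  ne q hq hlt := hfg q hlt ▸ h.ne q hq hlt
  mem q hq hlt := hfg q hlt ▸ h.mem q hq hlt
  marker q hq hlt := hfg q hlt ▸ h.marker q hq hlt
  second := h.second
  third := h.third
  next_nbr := h.next_nbr
  compl hu hw := by
    have hp := hfg _ (hpar u hu).2.1
    rw [← hp]
    refine (h.compl hu fun w h₁ h₂ => ?_).imp_right fun h' u' h₁ h₂ h₃ => hfg u' h₂ ▸ h' u' h₁ h₂ h₃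
    rw [hp, hfg w h₂]
    exact hw w h₁ h₂
  twin hu u' h₁ h₂ h₃ h₄ := by
    rintro ⟨w, h₅, h₆, h₇, h₈⟩
    rw [← hfg u' h₂]
    refine h.twin hu u' h₁ h₂ h₃ h₄ ⟨w, h₅, h₆, h₇, ?_⟩
    rw [hfg _ (hpar u hu).2.1, hfg w (h₅.trans h₂), h₈]

theorem IsFirstNbr.par_eq_root (hpar : IsFirstNbr G rk r par) (ho : IsSearchOrder G rk r s)
    (hu : G.Adj r u) : par u = r :=
  ho.injective (by
    have h₁ := (hpar u hu.ne').2.2 r hu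
    have h₂ := ho.root
    omega)

theorem exists_isFourStep_root (ho : IsSearchOrder G rk r s) :
    ∃ t, IsFourStep G rk par r s r t f := by
  have hno : ∀ q, ¬ rk q < rk r := fun q => by rw [ho.root]; exact Nat.not_lt_zero _
  refine ⟨({0, 1}, fun _ => 0), (by dsimp only; decide), fun _ => rfl, fun q _ h => absurd h (hno q),
    fun q _ h => absurd h (hno q), fun q _ h => absurd h (hno q), fun h => absurd h ho.adj.ne,
    fun h => ?_, fun h => absurd rfl h.ne, fun h => absurd rfl h, fun h => absurd rfl h⟩
  have := ho.root
  omega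

theorem exists_isFourStep_second (ho : IsSearchOrder G rk r s) (hpar : IsFirstNbr G rk r par)
    (hf : IsFourStep G rk par r s r (f r) f) : ∃ t, IsFourStep G rk par r s s t f := by
  have h0 := ho.root
  have h1 := ho.second
  have hlt : ∀ q, rk q < rk s → q = r := fun q hq => ho.injective (by omega)
  have hrP := hf.root rfl
  have hps := hpar.par_eq_root ho ho.adj
  refine ⟨({2, 3}, fun _ => (0, 2)), (by dsimp only; decide), fun h => absurd h ho.adj.ne', fun q _ hq => ?_,
    fun q _ hq => ?_, fun q _ hq h => absurd ⟨rfl, hlt q hq⟩ h, fun _ => ⟨rfl, rfl⟩,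
    fun h => by omega, fun _ h => absurd rfl h, fun _ _ => ⟨?_, fun u' h hu' => absurd (hlt u' hu') h⟩,
    fun _ u' h hu' => absurd (hlt u' hu') h⟩
  · rw [hlt q hq, hrP]
    dsimp only
    decide
  · rw [hlt q hq, hrP]
    dsimp only
    decide
  · rw [hps, hrP]
    dsimp only
    decide

theorem exists_isFourStep_third (ho : IsSearchOrder G rk r s) (hpar : IsFirstNbr G rk r par)
    (hf : IsFourStep G rk par r s s (f s) f) (hu : rk u = 2) (hru : ¬ G.Adj r u) :
    ∃ t, IsFourStep G rk par r s u t f := by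
  have h0 := ho.root
  have h1 := ho.second
  have hur : u ≠ r := by rintro rfl; omega
  have hus : u ≠ s := by rintro rfl; omega
  have hlt : ∀ q, q ≠ r → rk q < rk u → q = s := fun q hq hlt => ho.injective (by
    have := ho.injective.ne hq
    omega)
  have hlt' : ∀ q, G.Adj q u → rk q < rk u → q = s := fun q hq hlt' =>
    hlt q (fun h => hru (h ▸ hq)) hlt'
  have hps : par u = s := hlt' _ (hpar u hur).1 (hpar u hur).2.1
  have hpar_s : par s = r := hpar.par_eq_root ho ho.adj
  have hsP := (hf.second rfl).1
  have hsib : ∀ u', u' ≠ r → rk u' < rk u → par u' ≠ par u := fun u' h₁ h₂ h₃ => by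
    rw [hlt u' h₁ h₂, hps, hpar_s] at h₃
    exact ho.adj.ne h₃
  refine ⟨({0, 1}, fun _ => (3, 1)), (by dsimp only; decide), fun h => absurd h hur, fun q h hq => ?_,
    fun q h hq => ?_, fun q _ _ _ _ => (by dsimp only; decide), fun h => absurd h hus, fun _ _ => ⟨rfl, rfl⟩,
    fun h => absurd h hru, fun _ _ => ⟨?_, fun u' h₁ h₂ h₃ => absurd h₃ (hsib u' h₁ h₂)⟩,
    fun _ u' h₁ h₂ _ h₃ => absurd h₃ (hsib u' h₁ h₂)⟩
  · rw [hlt' q h hq, hsP]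
    dsimp only
    decide
  · rw [hlt' q h hq, hsP]
    dsimp only
    decide
  · rw [hps, hsP]
    dsimp only
    decide

theorem not_rank_lt_rank_apply (hrk : Function.Injective rk) (hpar : IsFirstNbr G rk r par)
    (hf : ∀ u, IsFourStep G rk par r s u (f u) f)
    (hc : IsPaletteColouring G (fun u => (f u).1) (arcColour rk fun u => (f u).2)) {φ : G ≃g G}
    (hφ : ∀ u v, G.Adj u v → arcColour rk (fun u => (f u).2) (φ u) (φ v) =
      arcColour rk (fun u => (f u).2) u v) (hur : u ≠ r) (hφr : φ u ≠ r)
    (hfix : ∀ q, rk q < rk u → φ q = q) : ¬ rk u < rk (φ u) := by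
  intro hlt
  obtain ⟨hvu, hvlt, hvmin⟩ := hpar u hur
  obtain ⟨hvu', hvlt', hvmin'⟩ := hpar _ hφr
  have hsame : ∀ q, G.Adj q u → rk q < rk u → (f (φ u)).2 q = (f u).2 q := fun q h₁ h₂ =>
    eq_of_arcColour_eq hφ h₁ (hfix q h₂) h₂ (h₂.trans hlt)
  have hp : par (φ u) = par u := by
    have hadj := (adj_apply_iff_of_apply_eq φ (hfix _ hvlt) u).2 hvu
    have hle := hvmin' _ hadj
    refine hrk (hle.antisymm (hvmin _ ?_))
    have hfp := hfix _ (hle.trans_lt hvlt)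
    exact (adj_apply_iff_of_apply_eq φ hfp u).1 hvu'
  by_cases hC : ∃ w, G.Adj w u ∧ rk w < rk u ∧ (f w).1 = (f (par u)).1ᶜ
  · obtain ⟨w, h₁, h₂, h₃⟩ := hC
    have hw := (adj_apply_iff_of_apply_eq φ (hfix w h₂) u).2 h₁
    refine (hf (φ u)).twin hφr u hur hlt (hc.not_adj_apply hφ u) hp.symm
      ⟨w, h₂, h₁, hw, by rw [hp, h₃]⟩ ?_
    have m₁ := Finset.mem_sdiff.1 ((hf u).mem _ hvu hvlt).2
    have m₂ := Finset.mem_sdiff.1 ((hf u).mem w h₁ h₂).2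
    have m₃ := Finset.mem_sdiff.1 ((hf (φ u)).mem _ (hp ▸ hvu') (hvlt.trans hlt)).2
    have m₄ := Finset.mem_sdiff.1 ((hf (φ u)).mem w hw (h₂.trans hlt)).2
    rw [hsame _ hvu hvlt] at m₃
    rw [hsame w h₁ h₂] at m₄
    rw [h₃] at m₂
    exact eq_of_common_pair (hf _).card_eq (hf _).card_eq m₁.2 m₂.2 m₃.1 m₄.1 m₁.1 m₂.1
  · obtain ⟨hPu, -⟩ := (hf u).compl hur fun w h₁ h₂ h₃ => hC ⟨w, h₁, h₂, h₃⟩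
    by_cases hC' : ∃ w, G.Adj w (φ u) ∧ rk w < rk (φ u) ∧ (f w).1 = (f (par u)).1ᶜ
    · obtain ⟨w, h₁, -, h₃⟩ := hC'
      obtain ⟨y, rfl⟩ := φ.surjective w
      have hy : G.Adj u y := (φ.map_adj_iff.1 h₁).symm
      refine (hc _ _ h₁.symm).2 ?_
      dsimp only
      rw [h₃, ← hPu, hφ u y hy]
      exact (hc _ _ hy).1
    · refine ((hf (φ u)).compl hφr fun w h₁ h₂ h₃ => hC' ⟨w, h₁, h₂, hp ▸ h₃⟩).2 u hur hlt hp.symm ?_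
      rw [hp, hsame _ hvu hvlt]

section Step

variable [Fintype V] [DecidableEq V] [DecidableRel G.Adj]

/-- The earlier vertices, other than the first two, with the same first neighbour as `u`. -/
def earlierSiblings (rk : V → ℕ) (par : V → V) (r s u : V) : Finset V :=
  Finset.univ.filter fun u' => rk u' < rk u ∧ par u' = par u ∧ u' ≠ r ∧ u' ≠ s

theorem mem_earlierSiblings {u' : V} : u' ∈ earlierSiblings rk par r s u ↔
    rk u' < rk u ∧ par u' = par u ∧ u' ≠ r ∧ u' ≠ s := by
  simp [earlierSiblings]

theorem exists_nbr_par (ho : IsSearchOrder G rk r s) (hpar : IsFirstNbr G rk r par) (hur : u ≠ r)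
    (hus : u ≠ s) : ∃ z, z ≠ u ∧ z ∉ earlierSiblings rk par r s u ∧
      insert u (insert z (earlierSiblings rk par r s u)) ⊆ G.neighborFinset (par u) ∧
      (par u = r → z = s) ∧ (par u ≠ r → rk z < rk (par u)) := by
  have hsib : ∀ u' ∈ earlierSiblings rk par r s u, G.Adj (par u) u' := fun u' hu' => by
    obtain ⟨-, h₁, h₂, -⟩ := mem_earlierSiblings.1 hu'
    exact h₁ ▸ (hpar u' h₂).1
  have hsub : ∀ z, G.Adj (par u) z →
      insert u (insert z (earlierSiblings rk par r s u)) ⊆ G.neighborFinset (par u) := by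
    intro z hz x hx
    rw [SimpleGraph.mem_neighborFinset]
    rcases Finset.mem_insert.1 hx with rfl | hx
    · exact (hpar x hur).1
    rcases Finset.mem_insert.1 hx with rfl | hx
    exacts [hz, hsib x hx]
  by_cases hv : par u = r
  · exact ⟨s, hus.symm, fun h => (mem_earlierSiblings.1 h).2.2.2 rfl,
      hsub s (by rw [hv]; exact ho.adj), fun _ => rfl, fun h => absurd hv h⟩
  · have h₁ := hpar _ hv
    have h₂ := (hpar u hur).2.1
    refine ⟨par (par u), fun h => ?_, fun h => ?_, hsub _ h₁.1.symm, fun h => absurd h hv,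
      fun _ => h₁.2.1⟩
    · rw [h] at h₁
      omega
    · obtain ⟨-, h₃, h₄, -⟩ := mem_earlierSiblings.1 h
      have h₅ := (hpar _ h₄).2.1
      rw [h₃] at h₅
      have := h₁.2.1
      omega

theorem card_earlierSiblings_le (hdeg : ∀ v, G.degree v ≤ 4) (ho : IsSearchOrder G rk r s)
    (hpar : IsFirstNbr G rk r par) (hur : u ≠ r) (hus : u ≠ s) :
    (earlierSiblings rk par r s u).card ≤ 2 := by
  obtain ⟨z, h₁, h₂, h₃, -⟩ := exists_nbr_par ho hpar hur hus
  have h₄ := Finset.card_le_card h₃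
  rw [G.card_neighborFinset_eq_degree, Finset.card_insert_of_notMem, Finset.card_insert_of_notMem h₂]
    at h₄
  · have := hdeg (par u)
    omega
  · rw [Finset.mem_insert, not_or]
    exact ⟨h₁.symm, fun h => (mem_earlierSiblings.1 h).1.ne rfl⟩

theorem exists_isFourStep_of_forall_ne (hdeg : ∀ v, G.degree v ≤ 4) (ho : IsSearchOrder G rk r s)
    (hpar : IsFirstNbr G rk r par) (hf : ∀ w, rk w < rk u → IsFourStep G rk par r s w (f w) f)
    (hur : u ≠ r) (hus : u ≠ s) (hu : rk u = 2 → G.Adj r u)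
    (hC : ∀ w, G.Adj w u → rk w < rk u → (f w).1 ≠ (f (par u)).1ᶜ) :
    ∃ t, IsFourStep G rk par r s u t f := by
  obtain ⟨hvu, hvlt, -⟩ := hpar u hur
  set v := par u with hv
  have hPv := (hf v hvlt).card_eq
  have hcompl : (f v).1ᶜ.card = 2 := by
    rw [Finset.card_compl, hPv]
    rfl
  have hsr : rk r < rk u ∧ rk s < rk u := by
    have h0 := ho.root
    have h1 := ho.second
    have := ho.injective.ne hur
    have := ho.injective.ne hus
    omega
  have hQr : G.Adj r u → (f v).1 = {0, 1} := fun h => by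
    rw [hv, hpar.par_eq_root ho h]
    exact (hf r hsr.1).root rfl
  obtain ⟨a, haD, haB⟩ : ∃ a ∈ (f v).1 ×ˢ (f v).1ᶜ, a ∉ insert (markerPair (f v).1)
      ((earlierSiblings rk par r s u).image fun u' => (f u').2 v) := by
    refine Finset.exists_mem_notMem_of_card_lt_card ?_
    rw [Finset.card_product, hPv, hcompl]
    have h₁ := Finset.card_insert_le (markerPair (f v).1)
      ((earlierSiblings rk par r s u).image fun u' => (f u').2 v)
    have h₂ := Finset.card_image_le (s := earlierSiblings rk par r s u) (f := fun u' => (f u').2 v)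
    have := card_earlierSiblings_le hdeg ho hpar hur hus
    omega
  rw [Finset.mem_product, Finset.mem_compl] at haD
  rw [Finset.mem_insert, not_or] at haB
  have hq : ∀ q, ∃ b : Fin 4 × Fin 4, G.Adj q u → rk q < rk u →
      (b.1 ∈ (f q).1 \ (f v).1ᶜ ∧ b.2 ∈ (f v).1ᶜ \ (f q).1) ∧
      ((f v).1ᶜ = (f q).1ᶜ → b ≠ (0, 2) ∧ b ≠ (2, 0)) ∧ (q = v → b = a) := by
    intro q
    by_cases hqv : q = v
    · subst hqv
      refine ⟨a, fun _ _ => ⟨?_, fun _ => ⟨fun h => ?_, fun h => ?_⟩, fun _ => rfl⟩⟩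
      · simpa using haD
      · exact haB.1 (eq_markerPair haD.1 haD.2 (Or.inl h))
      · exact haB.1 (eq_markerPair haD.1 haD.2 (Or.inr h))
    · by_cases hqu : G.Adj q u ∧ rk q < rk u
      · obtain ⟨b, hb⟩ := exists_pair_ne_marker (f q).1 (f v).1ᶜ (hf q hqu.2).card_eq hcompl
          (hC q hqu.1 hqu.2).symm
        exact ⟨b, fun _ _ => ⟨hb.1, hb.2, fun h => absurd h hqv⟩⟩
      · exact ⟨0, fun h₁ h₂ => absurd ⟨h₁, h₂⟩ hqu⟩
  choose b hb using hq
  refine ⟨((f v).1ᶜ, b), hcompl, fun h => absurd h hur, fun q h₁ h₂ => (hC q h₁ h₂).symm,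
    fun q h₁ h₂ => (hb q h₁ h₂).1, fun q h₁ h₂ _ => (hb q h₁ h₂).2.1, fun h => absurd h hus,
    fun h₁ h₂ => absurd (hu h₁) h₂, fun h₁ _ _ => ?_, fun _ _ => ⟨rfl, fun u' h₁ h₂ h₃ => ?_⟩,
    fun _ u' _ h₂ _ h₃ => ?_⟩
  · dsimp only
    rw [hQr h₁]
    decide
  · dsimp only
    rw [(hb v hvu hvlt).2.2 rfl]
    by_cases hs : u' = s
    · subst hs
      have hvr : v = r := by rw [hv, ← h₃]; exact hpar.par_eq_root ho ho.adj
      refine fun h => haB.1 (h.trans ?_)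
      change (f u').2 v = _
      rw [hvr, ((hf u' h₂).second rfl).2, (hf r hsr.1).root rfl]
      decide
    · exact fun h => haB.2 (Finset.mem_image.2
        ⟨u', mem_earlierSiblings.2 ⟨h₂, h₃, h₁, hs⟩, h.symm⟩)
  · rintro ⟨w, h₄, -, h₅, h₆⟩
    exact absurd h₆ (hC w h₅ (h₄.trans h₂))

theorem IsSearchOrder.false_of_all_twins (hdeg : ∀ v, G.degree v ≤ 4) (ho : IsSearchOrder G rk r s)
    (hpar : IsFirstNbr G rk r par) (hf : ∀ w, rk w < rk u → IsFourStep G rk par r s w (f w) f)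
    (hord : (∀ v, v ≠ r → G.Adj r v) ∨ ∃ t, rk t = 2 ∧ G.Adj s t ∧ t ≠ r ∧ ¬ G.Adj r t ∧
      ((∀ w a b, w ≠ r → ¬ G.Adj r w → G.Adj r a → G.Adj r b → G.Adj w a → G.Adj w b → a = b) ∨
        ∃ t', rk t' = 3 ∧ G.Adj r t' ∧ G.Adj t t'))
    (hur : u ≠ r) (hus : u ≠ s) (hu4 : G.degree u = 4) {w : V} (hwu : G.Adj w u)
    (hwlt : rk w < rk u) (hw : (f w).1 = (f (par u)).1ᶜ)
    (htw : ∀ u' ∈ earlierSiblings rk par r s u, ¬ G.Adj u' u ∧ rk w < rk u' ∧ G.Adj w u')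
    (hcard : (earlierSiblings rk par r s u).card = 2) : False := by
  obtain ⟨hvu, hvlt, hvmin⟩ := hpar u hur
  obtain ⟨z, hz₁, hz₂, hz₃, hz₄, hz₅⟩ := exists_nbr_par ho hpar hur hus
  have hu_notMem : u ∉ earlierSiblings rk par r s u := fun h => (mem_earlierSiblings.1 h).1.ne rfl
  have hNv : ∀ x, G.Adj (par u) x → x = u ∨ x = z ∨ x ∈ earlierSiblings rk par r s u := by
    intro x hx
    rw [← SimpleGraph.mem_neighborFinset, ← Finset.eq_of_subset_of_card_le hz₃ ?_,
      Finset.mem_insert, Finset.mem_insert] at hx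
    · exact hx
    · rw [Finset.card_insert_of_notMem, Finset.card_insert_of_notMem hz₂, hcard,
        G.card_neighborFinset_eq_degree]
      · exact hdeg _
      · rw [Finset.mem_insert, not_or]
        exact ⟨hz₁.symm, hu_notMem⟩
  have hne : ∀ P : Finset (Fin 4), P ≠ Pᶜ := by decide
  have hwv : w ≠ par u := fun h => hne _ (by rw [← hw, h])
  obtain ⟨u₁, hu₁⟩ : (earlierSiblings rk par r s u).Nonempty := by
    rw [← Finset.card_pos, hcard]
    exact two_pos
  have hvw : rk (par u) < rk w := lt_of_le_of_ne (hvmin w hwu) fun h => hwv (ho.injective h).symm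
  by_cases hv : par u = r
  · rw [hz₄ hv] at hNv hz₃
    rw [hv] at hNv hvu hw hz₃ hwv
    have hadj : ∀ u' ∈ earlierSiblings rk par r s u, G.Adj r u' := fun u' h =>
      (G.mem_neighborFinset _ _).1 (hz₃ (Finset.mem_insert_of_mem (Finset.mem_insert_of_mem h)))
    rcases hord with hdom | ⟨t, ht, hst, htr, hrt, hord⟩
    · have h₁ : insert u (insert u₁ (G.neighborFinset u)) ⊆
          insert r (G.neighborFinset r) := fun x _ => by
        rw [Finset.mem_insert, SimpleGraph.mem_neighborFinset]
        exact or_iff_not_imp_left.2 (hdom x)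
      have h₂ := Finset.card_le_card h₁
      have h₃ := Finset.card_insert_le r (G.neighborFinset r)
      have h₄ := hdeg r
      rw [G.card_neighborFinset_eq_degree] at h₃
      rw [Finset.card_insert_of_notMem, Finset.card_insert_of_notMem,
        G.card_neighborFinset_eq_degree] at h₂
      · omega
      · rw [SimpleGraph.mem_neighborFinset]
        exact fun h => (htw u₁ hu₁).1 h.symm
      · rw [Finset.mem_insert, SimpleGraph.mem_neighborFinset, not_or]
        exact ⟨fun h => hu_notMem (h ▸ hu₁), G.irrefl⟩
    · have htu : t ≠ u := fun h => hrt (h ▸ hvu)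
      have hlt : rk t < rk u := by
        have h0 := ho.root
        have h1 := ho.second
        have := ho.injective.ne hur
        have := ho.injective.ne hus
        have := ho.injective.ne htu
        omega
      have hus' : ¬ G.Adj r w := by
        intro hrw
        rcases hNv w hrw with rfl | rfl | h
        · exact hwlt.ne rfl
        · have h₁ : insert r (insert t (insert u (earlierSiblings rk par r w u))) ⊆
              G.neighborFinset w := by
            intro x hx
            rw [SimpleGraph.mem_neighborFinset]
            simp only [Finset.mem_insert] at hx
            rcases hx with rfl | rfl | rfl | hx
            exacts [hrw.symm, hst, hwu, (htw x hx).2.2]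
          have h₂ := Finset.card_le_card h₁
          rw [Finset.card_insert_of_notMem, Finset.card_insert_of_notMem,
            Finset.card_insert_of_notMem hu_notMem, hcard, G.card_neighborFinset_eq_degree] at h₂
          · have := hdeg w
            omega
          · rw [Finset.mem_insert, not_or]
            exact ⟨htu, fun h => hrt (hadj t h)⟩
          · simp only [Finset.mem_insert, not_or]
            exact ⟨htr.symm, hur.symm, fun h => (mem_earlierSiblings.1 h).2.2.1 rfl⟩
        · exact (htw w h).1 hwu
      rcases hord with huniq | ⟨t', ht', hrt', -⟩
      · exact hu_notMem (huniq w u u₁ hwv hus' hvu (hadj u₁ hu₁) hwu (htw u₁ hu₁).2.2 ▸ hu₁)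
      · have hwt' : rk w < rk t' := by
          rcases hNv t' hrt' with rfl | rfl | h
          · exact hwlt
          · have := ho.second
            omega
          · exact (htw t' h).2.1
        have hwt : w = t := ho.injective (by
          have h0 := ho.root
          have h1 := ho.second
          have := ho.injective.ne hwv
          have : rk w ≠ rk s := ho.injective.ne fun h => hus' (h ▸ ho.adj)
          omega)
        rw [hwt, ((hf t hlt).third ht hrt).1, (hf r (by rw [ho.root]; omega)).root rfl] at hw
        exact absurd hw (by decide)
  · obtain ⟨x, hx, hvx⟩ := ho.adj_succ _ u hvu hvlt
    rcases hNv x hvx with rfl | rfl | h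
    · omega
    · have := hz₅ hv
      omega
    · have := (htw x h).2.1
      omega

theorem exists_isFourStep_of_exists_eq (hdeg : ∀ v, G.degree v ≤ 4) (ho : IsSearchOrder G rk r s)
    (hpar : IsFirstNbr G rk r par) (hf : ∀ w, rk w < rk u → IsFourStep G rk par r s w (f w) f)
    (hord : (∀ v, v ≠ r → G.Adj r v) ∨ ∃ t, rk t = 2 ∧ G.Adj s t ∧ t ≠ r ∧ ¬ G.Adj r t ∧
      ((∀ w a b, w ≠ r → ¬ G.Adj r w → G.Adj r a → G.Adj r b → G.Adj w a → G.Adj w b → a = b) ∨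
        ∃ t', rk t' = 3 ∧ G.Adj r t' ∧ G.Adj t t'))
    (hur : u ≠ r) (hus : u ≠ s) (hu : rk u = 2 → G.Adj r u) {w : V} (hwu : G.Adj w u)
    (hwlt : rk w < rk u) (hw : (f w).1 = (f (par u)).1ᶜ) :
    ∃ t, IsFourStep G rk par r s u t f := by
  classical
  obtain ⟨hvu, hvlt, -⟩ := hpar u hur
  have hne : ∀ P : Finset (Fin 4), P ≠ Pᶜ := by decide
  have hwv : w ≠ par u := fun h => hne _ (by rw [← hw, h])
  have htwin_ne : ∀ u', u' ≠ r → par u' = par u →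
      (∃ w', rk w' < rk u' ∧ G.Adj w' u' ∧ G.Adj w' u ∧ (f w').1 = (f (par u)).1ᶜ) → u' ≠ s := by
    rintro u' h₁ h₂ ⟨w', h₃, -, -, h₄⟩ rfl
    rw [← h₂, hpar.par_eq_root ho ho.adj] at h₄
    have h0 := ho.root
    have h1 := ho.second
    rw [show w' = r from ho.injective (by omega)] at h₄
    exact hne _ h₄
  obtain ⟨E, hE⟩ : ∃ E : Finset V, ∀ q, q ∈ E ↔
      G.Adj q u ∧ rk q < rk u ∧ q ≠ par u ∧ (f q).1 ≠ (f (par u)).1ᶜ :=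
    ⟨Finset.univ.filter fun q => G.Adj q u ∧ rk q < rk u ∧ q ≠ par u ∧ (f q).1 ≠ (f (par u)).1ᶜ,
      fun q => by simp⟩
  obtain ⟨T, hT⟩ : ∃ T : Finset V, ∀ u', u' ∈ T ↔ u' ∈ earlierSiblings rk par r s u ∧
      ¬ G.Adj u' u ∧
      ∃ w', rk w' < rk u' ∧ G.Adj w' u' ∧ G.Adj w' u ∧ (f w').1 = (f (par u)).1ᶜ :=
    ⟨(earlierSiblings rk par r s u).filter fun u' => ¬ G.Adj u' u ∧
      ∃ w', rk w' < rk u' ∧ G.Adj w' u' ∧ G.Adj w' u ∧ (f w').1 = (f (par u)).1ᶜ,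
      fun q => Finset.mem_filter⟩
  obtain ⟨X, hX₁, hX₂, hX₃⟩ : ∃ X : Finset (Finset (Fin 4)), X.card ≤ 1 ∧
      (X.card ≠ 0 → T = ∅) ∧
      (G.Adj r u → u ≠ s → (∀ q, G.Adj r q → rk q < rk u → q = s) → {1, 2} ∈ X) := by
    by_cases h : G.Adj r u ∧ ∀ q, G.Adj r q → rk q < rk u → q = s
    · refine ⟨{{1, 2}}, le_rfl, fun _ => Finset.eq_empty_of_forall_notMem fun u' hu' => ?_,
        fun _ _ _ => Finset.mem_singleton_self _⟩
      obtain ⟨h₁, h₂, h₃⟩ := (hT u').1 hu'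
      obtain ⟨h₄, h₅, h₆, h₇⟩ := mem_earlierSiblings.1 h₁
      refine h₇ (h.2 u' ?_ h₄)
      rw [← hpar.par_eq_root ho h.1, ← h₅]
      exact (hpar u' h₆).1
    · exact ⟨∅, Nat.zero_le _, fun h => absurd rfl h, fun h₁ _ h₂ => absurd ⟨h₁, h₂⟩ h⟩
  have hEsub : insert (par u) (insert w E) ⊆ G.neighborFinset u := by
    intro x hx
    rw [SimpleGraph.mem_neighborFinset]
    simp only [Finset.mem_insert, hE] at hx
    rcases hx with rfl | rfl | hx
    exacts [hvu.symm, hwu.symm, hx.1.symm]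
  have hEcard : (insert (par u) (insert w E)).card = E.card + 2 := by
    rw [Finset.card_insert_of_notMem, Finset.card_insert_of_notMem]
    · exact fun h => ((hE w).1 h).2.2.2 hw
    · rw [Finset.mem_insert, not_or]
      exact ⟨hwv.symm, fun h => ((hE _).1 h).2.2.1 rfl⟩
  have hEle := Finset.card_le_card hEsub
  rw [hEcard, G.card_neighborFinset_eq_degree] at hEle
  have hTsub : T ⊆ earlierSiblings rk par r s u := fun x hx => ((hT x).1 hx).1
  have hTle := Finset.card_le_card hTsub
  have hsib := card_earlierSiblings_le hdeg ho hpar hur hus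
  have hdu := hdeg u
  have hET : E.card + T.card < 4 := by
    by_contra hcon
    have hTeq := Finset.eq_of_subset_of_card_le hTsub (by omega)
    have hEeq := Finset.eq_of_subset_of_card_le hEsub
      (by rw [hEcard, G.card_neighborFinset_eq_degree]; omega)
    have huniq : ∀ w', G.Adj w' u → (f w').1 = (f (par u)).1ᶜ → w' = w := by
      intro w' h₁ h₂
      have h₃ : w' ∈ insert (par u) (insert w E) := by
        rw [hEeq, SimpleGraph.mem_neighborFinset]
        exact h₁.symm
      simp only [Finset.mem_insert, hE] at h₃
      rcases h₃ with rfl | h₃ | h₃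
      · exact absurd h₂ (hne _)
      · exact h₃
      · exact absurd h₂ h₃.2.2.2
    refine ho.false_of_all_twins hdeg hpar hf hord hur hus (by omega) hwu hwlt hw
      (fun u' hu' => ?_) (by omega)
    rw [← hTeq] at hu'
    obtain ⟨-, h₁, w', h₂, h₃, h₄, h₅⟩ := (hT u').1 hu'
    rw [huniq w' h₄ h₅] at h₂ h₃
    exact ⟨h₁, h₂, h₃⟩
  obtain ⟨Q, hQ, hQB⟩ : ∃ Q ∈ (Finset.powersetCard 2 (Finset.univ : Finset (Fin 4))).filter
      fun T => T ≠ (f (par u)).1 ∧ T ≠ (f (par u)).1ᶜ,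
      Q ∉ (E.image fun q => (f q).1) ∪ (T.image fun q => (f q).1) ∪ X := by
    refine Finset.exists_mem_notMem_of_card_lt_card ?_
    rw [card_mixed_palettes _ (hf _ hvlt).card_eq]
    have h₁ := Finset.card_union_le ((E.image fun q => (f q).1) ∪ (T.image fun q => (f q).1)) X
    have h₂ := Finset.card_union_le (E.image fun q => (f q).1) (T.image fun q => (f q).1)
    have h₃ := Finset.card_image_le (s := E) (f := fun q => (f q).1)
    have h₄ := Finset.card_image_le (s := T) (f := fun q => (f q).1)
    by_cases h : X.card = 0
    · omega
    · have h₅ := congrArg Finset.card (hX₂ h)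
      rw [Finset.card_empty] at h₅
      omega
  obtain ⟨hQ₁, hQ₂, hQ₃⟩ := Finset.mem_filter.1 hQ
  have hQcard := (Finset.mem_powersetCard.1 hQ₁).2
  simp only [Finset.mem_union, not_or, Finset.mem_image, not_exists, not_and] at hQB
  have hQne : ∀ q, G.Adj q u → rk q < rk u → Q ≠ (f q).1 := by
    intro q h₁ h₂ h₃
    refine hQB.1.1 q ((hE q).2 ⟨h₁, h₂, ?_, ?_⟩) h₃.symm
    · rintro rfl
      exact hQ₂ h₃
    · rw [← h₃]
      exact hQ₃
  have hq : ∀ q, ∃ b : Fin 4 × Fin 4, G.Adj q u → rk q < rk u →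
      (b.1 ∈ (f q).1 \ Q ∧ b.2 ∈ Q \ (f q).1) ∧ (Q = (f q).1ᶜ → b ≠ (0, 2) ∧ b ≠ (2, 0)) := by
    intro q
    by_cases hqu : G.Adj q u ∧ rk q < rk u
    · obtain ⟨b, hb⟩ := exists_pair_ne_marker (f q).1 Q (hf q hqu.2).card_eq hQcard
        (hQne q hqu.1 hqu.2)
      exact ⟨b, fun _ _ => hb⟩
    · exact ⟨0, fun h₁ h₂ => absurd ⟨h₁, h₂⟩ hqu⟩
  choose b hb using hq
  refine ⟨(Q, b), hQcard, fun h => absurd h hur, hQne, fun q h₁ h₂ => (hb q h₁ h₂).1,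
    fun q h₁ h₂ _ => (hb q h₁ h₂).2, fun h => absurd h hus, fun h₁ h₂ => absurd (hu h₁) h₂,
    fun h₁ h₂ h₃ h₄ => hQB.2 ((show Q = {1, 2} from h₄) ▸ hX₃ h₁ h₂ h₃), fun _ h => absurd hw (h w hwu hwlt),
    fun _ u' h₁ h₂ h₃ h₄ h₅ h₆ => ?_⟩
  exact hQB.1.2 u' ((hT u').2
    ⟨mem_earlierSiblings.2 ⟨h₂, h₄, h₁, htwin_ne u' h₁ h₄ h₅⟩, h₃, h₅⟩) h₆.symm

theorem exists_isFourStep (hdeg : ∀ v, G.degree v ≤ 4) (ho : IsSearchOrder G rk r s)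
    (hpar : IsFirstNbr G rk r par) (hf : ∀ w, rk w < rk u → IsFourStep G rk par r s w (f w) f)
    (hord : (∀ v, v ≠ r → G.Adj r v) ∨ ∃ t, rk t = 2 ∧ G.Adj s t ∧ t ≠ r ∧ ¬ G.Adj r t ∧
      ((∀ w a b, w ≠ r → ¬ G.Adj r w → G.Adj r a → G.Adj r b → G.Adj w a → G.Adj w b → a = b) ∨
        ∃ t', rk t' = 3 ∧ G.Adj r t' ∧ G.Adj t t')) :
    ∃ t, IsFourStep G rk par r s u t f := by
  have h0 := ho.root
  have h1 := ho.second
  by_cases hur : u = r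
  · subst hur
    exact exists_isFourStep_root ho
  by_cases hus : u = s
  · subst hus
    exact exists_isFourStep_second ho hpar (hf r (by omega))
  by_cases hu : rk u = 2 → G.Adj r u
  · by_cases hC : ∃ w, G.Adj w u ∧ rk w < rk u ∧ (f w).1 = (f (par u)).1ᶜ
    · obtain ⟨w, h₁, h₂, h₃⟩ := hC
      exact exists_isFourStep_of_exists_eq hdeg ho hpar hf hord hur hus hu h₁ h₂ h₃
    · exact exists_isFourStep_of_forall_ne hdeg ho hpar hf hur hus hu
        fun w h₁ h₂ h₃ => hC ⟨w, h₁, h₂, h₃⟩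
  · obtain ⟨hu₁, hu₂⟩ := Classical.not_imp.1 hu
    exact exists_isFourStep_third ho hpar (hf s (by omega)) hu₁ hu₂

theorem exists_isFirstNbr (ho : IsSearchOrder G rk r s) : ∃ par, IsFirstNbr G rk r par := by
  have h : ∀ u, ∃ p, u ≠ r → G.Adj p u ∧ rk p < rk u ∧ ∀ q, G.Adj q u → rk p ≤ rk q := by
    intro u
    by_cases hu : u = r
    · exact ⟨u, fun h => absurd hu h⟩
    · obtain ⟨q₀, h₁, h₂⟩ := ho.exists_adj u hu
      obtain ⟨p, hp, hmin⟩ := (G.neighborFinset u).exists_min_image rk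
        ⟨q₀, (G.mem_neighborFinset _ _).2 h₁.symm⟩
      simp only [SimpleGraph.mem_neighborFinset] at hp hmin
      exact ⟨p, fun _ => ⟨hp.symm, (hmin q₀ h₁.symm).trans_lt h₂, fun q hq => hmin q hq.symm⟩⟩
  choose par hpar using h
  exact ⟨par, hpar⟩

theorem apply_root_eq (ho : IsSearchOrder G rk r s)
    (hf : ∀ u, IsFourStep G rk par r s u (f u) f) (hr : 2 ≤ G.degree r)
    (hord : (∀ v, v ≠ r → G.Adj r v) ∨ ∃ t, rk t = 2 ∧ G.Adj s t ∧ t ≠ r ∧ ¬ G.Adj r t)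
    (hc : IsPaletteColouring G (fun u => (f u).1) (arcColour rk fun u => (f u).2)) {φ : G ≃g G}
    (hφ : ∀ u v, G.Adj u v → arcColour rk (fun u => (f u).2) (φ u) (φ v) =
      arcColour rk (fun u => (f u).2) u v) : φ r = r := by
  by_contra hne
  obtain ⟨c, hcdef⟩ : ∃ c, c = arcColour rk fun u => (f u).2 := ⟨_, rfl⟩
  rw [← hcdef] at hc hφ
  have hna := hc.not_adj_apply hφ r
  rcases hord with hdom | ⟨t, ht, hst, htr, hrt⟩
  · exact hna (hdom _ hne)
  have h0 := ho.root
  have h1 := ho.second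
  have hmark : ∀ a b, G.Adj a b → c a b = 0 → c b a = 2 → ¬ (a = r ∧ b = s) →
      ¬ (a = s ∧ b = r) → (f b).1 ≠ (f a).1ᶜ := by
    intro a b hab h₁ h₂ h₃ h₄ h₅
    rcases lt_trichotomy (rk a) (rk b) with hlt | heq | hgt
    · rw [hcdef, arcColour_of_lt hlt] at h₁
      rw [hcdef, arcColour_of_gt hlt] at h₂
      exact ((hf b).marker a hab hlt (fun h => h₃ h.symm) h₅).1 (Prod.ext h₁ h₂)
    · exact hab.ne (ho.injective heq)
    · rw [hcdef, arcColour_of_gt hgt] at h₁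
      rw [hcdef, arcColour_of_lt hgt] at h₂
      exact ((hf a).marker b hab.symm hgt h₄ (by rw [h₅, compl_compl])).2 (Prod.ext h₂ h₁)
  have hrs : c r s = 0 ∧ c s r = 2 := by
    rw [hcdef, arcColour_of_lt (by omega), arcColour_of_gt (by omega), ((hf s).second rfl).2]
    exact ⟨rfl, rfl⟩
  rw [← hφ _ _ ho.adj, ← hφ _ _ ho.adj.symm] at hrs
  have hst3 : c s t = 3 := by
    rw [hcdef, arcColour_of_lt (by omega), ((hf t).third ht hrt).2]
  rw [← hφ _ _ hst] at hst3
  have hadj : G.Adj (φ r) (φ s) := φ.map_adj_iff.2 ho.adj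
  have hP : (f (φ r)).1 = {0, 3} := by
    have h₁ := hc _ _ hadj
    have h₂ := hc _ _ hadj.symm
    rw [hrs.1] at h₁
    rw [hrs.2] at h₂
    refine eq_zero_three _ _ ⟨(hf _).card_eq, (hf _).card_eq, hmark _ _ hadj hrs.1 hrs.2
      (fun h => hne h.1) fun h => hna (h.1 ▸ ho.adj)⟩ ⟨h₁, h₂⟩ ?_
    rw [← hst3]
    exact (hc _ _ (φ.map_adj_iff.2 hst)).1
  obtain ⟨q, hq, hmin⟩ := ((G.neighborFinset r).erase s).exists_min_image rk (by
    rw [← Finset.card_pos]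
    have := Finset.pred_card_le_card_erase (s := G.neighborFinset r) (a := s)
    rw [G.card_neighborFinset_eq_degree] at this
    omega)
  simp only [Finset.mem_erase, SimpleGraph.mem_neighborFinset] at hq hmin
  have hPr : (f r).1 = {0, 1} := (hf r).root rfl
  have hrq := hc _ _ hq.2
  have hqr := hc _ _ hq.2.symm
  have hrq' := hc _ _ (φ.map_adj_iff.2 hq.2)
  have hqr' := hc _ _ (φ.map_adj_iff.2 hq.2.symm)
  dsimp only at hrq hqr hrq' hqr'
  rw [hφ _ _ hq.2, hP] at hrq'
  rw [hφ _ _ hq.2.symm, hP] at hqr'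
  rw [hPr] at hrq hqr
  have hone : ∀ x : Fin 4, x ∈ ({0, 1} : Finset (Fin 4)) → x ∈ ({0, 3} : Finset (Fin 4)) →
      x = 0 := by decide
  have htwo : ∀ x : Fin 4, x ∉ ({0, 1} : Finset (Fin 4)) → x ∉ ({0, 3} : Finset (Fin 4)) →
      x = 2 := by decide
  have e₁ := hone _ hrq.1 hrq'.1
  have e₂ := htwo _ hqr.2 hqr'.2
  rw [e₁] at hrq
  rw [e₂] at hqr
  rcases eq_one_two_or_two_three _ (hf q).card_eq hqr.1 hrq.2 with h | h
  · refine (hf q).next_nbr hq.2 hq.1 (fun x hx hlt => ?_) h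
    by_contra hxs
    exact (hmin x ⟨hxs, hx⟩).not_gt hlt
  · exact hmark r q hq.2 e₁ e₂ (fun h => hq.1 h.2) (fun h => ho.adj.ne h.1) (by rw [h, hPr])

end Step

theorem exists_colouring_four [Fintype V] [DecidableEq V] [DecidableRel G.Adj]
    (hconn : G.Connected) (h₂ : 2 ≤ G.maxDegree) (h₄ : G.maxDegree ≤ 4) :
    ∃ c : V → V → Fin 4, NoMono2Path G c ∧ IsDistinguishing G c := by
  have := hconn.nonempty
  obtain ⟨r, hr⟩ := G.exists_maximal_degree_vertex
  have hdeg : ∀ v, G.degree v ≤ 4 := fun v => (G.degree_le_maxDegree v).trans h₄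
  obtain ⟨rk, s, ho, hord⟩ := exists_isSearchOrder hconn (r := r) (by
    rw [← SimpleGraph.degree_pos_iff_exists_adj]
    omega)
  obtain ⟨par, hpar⟩ := exists_isFirstNbr ho
  obtain ⟨f, hf⟩ := exists_forall_of_greedy ho.injective
    (fun u (t : Finset (Fin 4) × (V → Fin 4 × Fin 4)) f => IsFourStep G rk par r s u t f)
    (fun u t f g hfg h => h.congr hpar hfg)
    (fun u f hf => exists_isFourStep hdeg ho hpar hf hord)
  have hc := isPaletteColouring_arcColour (P := fun u => (f u).1) (h := fun u => (f u).2)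
    ho.injective fun u => (hf u).mem
  refine ⟨_, hc.noMono2Path, fun φ hφ => forall_eq_of_injective_rank ho.injective φ.injective
    fun u hfix => ?_⟩
  have hφr := apply_root_eq ho hf (by omega)
    (hord.imp_right fun ⟨t, h₁, h₂, h₃, h₄, _⟩ => ⟨t, h₁, h₂, h₃, h₄⟩) hc hφ
  by_cases hur : u = r
  · rw [hur, hφr]
    exact lt_irrefl _
  · exact not_rank_lt_rank_apply ho.injective hpar hf hc hφ hur (fun h => hur (φ.injective (h.trans hφr.symm)))
      hfix

end FourColours

section SmallDegree

variable {V : Type*} [Fintype V] [DecidableEq V] {G : SimpleGraph V} [DecidableRel G.Adj]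

theorem exists_colouring_two (hconn : G.Connected) (hedge : ∃ u v, G.Adj u v)
    (hdeg : G.maxDegree ≤ 1) : ∃ c : V → V → Fin 2, NoMono2Path G c ∧ IsDistinguishing G c := by
  have huniq : ∀ x y z, G.Adj x y → G.Adj x z → y = z := fun x y z hy hz => by
    have h := (G.degree_le_maxDegree x).trans hdeg
    rw [← G.card_neighborFinset_eq_degree, Finset.card_le_one] at h
    exact h y ((G.mem_neighborFinset _ _).2 hy) z ((G.mem_neighborFinset _ _).2 hz)
  obtain ⟨r, s, hrs⟩ := hedge
  have hall : ∀ x, x = r ∨ x = s := by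
    intro x
    by_contra hx
    obtain ⟨a, b, ha, hb, hab⟩ := hconn.exists_adj_mem_notMem (S := {r, s}) (Set.mem_insert r _) hx
    rcases ha with rfl | rfl
    · exact hb (Or.inr (huniq _ _ _ hab hrs))
    · exact hb (Or.inl (huniq _ _ _ hab hrs.symm))
  refine ⟨fun u _ => if u = r then 0 else 1,
    fun u v w huv hvw hne => absurd (huniq v w u hvw huv.symm) hne, fun φ hφ => ?_⟩
  have hr : φ r = r := by
    have h := hφ r s hrs
    dsimp only at h
    rw [if_pos rfl] at h
    by_contra hne
    rw [if_neg hne] at h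
    exact absurd h (by decide)
  intro x
  rcases hall x with rfl | rfl
  · exact hr
  · exact (hall _).resolve_left fun h => hrs.ne (φ.injective (hr.trans h.symm))

theorem forall_apply_eq_of_adj (hconn : G.Connected) (hdeg : G.maxDegree ≤ 2) {φ : G ≃g G} {a b : V}
    (hab : G.Adj a b) (ha : φ a = a) (hb : φ b = b) (x : V) : φ x = x := by
  by_contra hx
  obtain ⟨y, z, ⟨hy, w, hyw, hw⟩, hz, hyz⟩ := hconn.exists_adj_mem_notMem
    (S := {v | φ v = v ∧ ∃ w, G.Adj v w ∧ φ w = w}) ⟨ha, b, hab, hb⟩ fun h => hx h.1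
  have hzφ : φ z ≠ z := fun h => hz ⟨h, y, hyz.symm, hy⟩
  have hwz : w ≠ z := fun h => hzφ (h ▸ hw)
  have hwφ : w ≠ φ z := fun h => hwz (φ.injective (hw.trans h))
  have hsub : {w, z, φ z} ⊆ G.neighborFinset y := by
    intro v hv
    rw [SimpleGraph.mem_neighborFinset]
    simp only [Finset.mem_insert, Finset.mem_singleton] at hv
    rcases hv with rfl | rfl | rfl
    exacts [hyw, hyz, (adj_apply_iff_of_apply_eq φ hy z).2 hyz]
  have h := Finset.card_le_card hsub
  rw [Finset.card_eq_three.2 ⟨_, _, _, hwz, hwφ, hzφ.symm, rfl⟩,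
    G.card_neighborFinset_eq_degree] at h
  have := G.degree_le_maxDegree y
  omega

theorem exists_colouring_three_of_colouring (hconn : G.Connected) (hdeg : G.maxDegree ≤ 2)
    {r s : V} (hrs : G.Adj r s) {t : V → Fin 2} (ht : ∀ u v, G.Adj u v → t u ≠ t v) :
    ∃ c : V → V → Fin 3, NoMono2Path G c ∧ IsDistinguishing G c := by
  obtain ⟨c, hc⟩ : ∃ c : V → V → Fin 3, ∀ u v, c u v =
      if t u = t r then 0 else if u = s ∧ v = r then 2 else 1 := ⟨_, fun _ _ => rfl⟩
  have h0 : ∀ u v, c u v = 0 ↔ t u = t r := by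
    intro u v
    rw [hc]
    split_ifs with h₁ h₂ <;> simp [h₁]
  have h2 : ∀ u v, c u v = 2 → u = s ∧ v = r := by
    intro u v
    rw [hc]
    split_ifs with h₁ h₂
    · exact fun h => absurd h (by decide)
    · exact fun _ => h₂
    · exact fun h => absurd h (by decide)
  refine ⟨c, fun u v w huv _ _ h => ?_, fun φ hφ => ?_⟩
  · have h₁ := (h0 u v).symm
    rw [h, h0 v w] at h₁
    have h₂ := ht u v huv
    omega
  · have h := hφ s r hrs.symm
    rw [hc s r, if_neg (ht s r hrs.symm), if_pos ⟨rfl, rfl⟩] at h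
    exact forall_apply_eq_of_adj hconn hdeg hrs (h2 _ _ h).2 (h2 _ _ h).1

theorem exists_colouring_three (hconn : G.Connected) (hedge : ∃ u v, G.Adj u v)
    (hdeg : G.maxDegree ≤ 2) : ∃ c : V → V → Fin 3, NoMono2Path G c ∧ IsDistinguishing G c := by
  classical
  obtain ⟨r, s, hrs⟩ := hedge
  obtain ⟨T, hTG, hT⟩ := hconn.exists_isTree_le
  obtain ⟨t⟩ := hT.isAcyclic.colorable_two
  by_cases ht : ∀ u v, G.Adj u v → t u ≠ t v
  · exact exists_colouring_three_of_colouring hconn hdeg hrs ht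
  push Not at ht
  obtain ⟨w, z, hwz, htwz⟩ := ht
  have hTcard := hT.card_edgeFinset
  have hGcard : G.edgeFinset.card ≤ Fintype.card V := by
    have h₁ := G.sum_degrees_eq_twice_card_edges
    have h₂ := Finset.sum_le_card_nsmul Finset.univ (fun v => G.degree v) 2
      fun v _ => (G.degree_le_maxDegree v).trans hdeg
    rw [smul_eq_mul, Finset.card_univ] at h₂
    omega
  have hextra : (G.edgeFinset \ T.edgeFinset).card ≤ 1 := by
    rw [Finset.card_sdiff_of_subset (SimpleGraph.edgeFinset_mono hTG)]
    omega
  have hmem : ∀ a b, G.Adj a b → t a = t b → s(a, b) ∈ G.edgeFinset \ T.edgeFinset := by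
    intro a b h₁ h₂
    rw [Finset.mem_sdiff, SimpleGraph.mem_edgeFinset, SimpleGraph.mem_edgeFinset]
    exact ⟨h₁, fun h => t.valid h h₂⟩
  have huniq : ∀ a b, G.Adj a b → t a = t b → s(a, b) = s(w, z) := fun a b h₁ h₂ =>
    Finset.card_le_one.1 hextra _ (hmem a b h₁ h₂) _ (hmem w z hwz htwz)
  obtain ⟨col, hcol⟩ : ∃ col : V → Fin 3, ∀ v, col v = if v = w then 2 else (t v).castSucc :=
    ⟨_, fun _ => rfl⟩
  have hcolw : ∀ v, col v = 2 ↔ v = w := by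
    intro v
    rw [hcol]
    split_ifs with h
    · exact ⟨fun _ => h, fun _ => rfl⟩
    · exact ⟨fun h' => absurd h' (Fin.castSucc_lt_last _).ne, fun h' => absurd h' h⟩
  have hproper : ∀ a b, G.Adj a b → col a ≠ col b := by
    intro a b hab h
    by_cases ha : a = w
    · rw [(hcolw a).2 ha] at h
      exact hab.ne (ha.trans ((hcolw b).1 h.symm).symm)
    · have hb : b ≠ w := fun hb => ha ((hcolw a).1 (h.trans ((hcolw b).2 hb)))
      rw [hcol a, hcol b, if_neg ha, if_neg hb] at h
      rcases Sym2.eq_iff.1 (huniq a b hab (Fin.castSucc_injective _ h)) with h | h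
      exacts [ha h.1, hb h.2]
  refine ⟨fun u _ => col u, fun u v x huv _ _ => hproper u v huv, fun φ hφ => ?_⟩
  have hw : φ w = w := (hcolw _).1 ((hφ w z hwz).trans ((hcolw w).2 rfl))
  have hφz : G.Adj w (φ z) := (adj_apply_iff_of_apply_eq φ hw z).2 hwz
  refine forall_apply_eq_of_adj hconn hdeg hwz hw ?_
  have h := hφ z w hwz.symm
  dsimp only at h
  rw [hcol, hcol, if_neg hφz.ne', if_neg hwz.ne'] at h
  have := Fin.castSucc_injective _ h
  rcases Sym2.eq_iff.1 (huniq w (φ z) hφz (htwz.trans this.symm)) with h | h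
  exacts [h.2, absurd h.1 hwz.ne]

end SmallDegree

theorem stmt14 {V : Type*} [Fintype V] [DecidableEq V]
    (G : SimpleGraph V) [DecidableRel G.Adj]
    (hconn : G.Connected) (hedge : ∃ u v : V, G.Adj u v) :
    ∃ c : V → V → Fin ⌈2 * Real.sqrt (G.maxDegree : ℝ)⌉₊,
      NoMono2Path G c ∧ IsDistinguishing G c := by
  obtain ⟨k, hk⟩ : ∃ k, k = ⌈2 * Real.sqrt (G.maxDegree : ℝ)⌉₊ := ⟨_, rfl⟩
  have hpos : 0 < G.maxDegree := by
    obtain ⟨u, v, huv⟩ := hedge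
    exact ((G.degree_pos_iff_exists_adj u).2 ⟨v, huv⟩).trans_le (G.degree_le_maxDegree u)
  have hsq := Real.sq_sqrt (Nat.cast_nonneg (α := ℝ) G.maxDegree)
  have hsqrt := Real.sqrt_pos.2 (Nat.cast_pos (α := ℝ).2 hpos)
  have hle : 4 * G.maxDegree ≤ k * k := by
    have h := Nat.le_ceil (2 * Real.sqrt (G.maxDegree : ℝ))
    rw [← hk] at h
    have : (4 * G.maxDegree : ℝ) ≤ k * k := by nlinarith
    exact_mod_cast this
  obtain ⟨j, rfl⟩ : ∃ j, k = j + 1 := Nat.exists_eq_succ_of_ne_zero (by rintro rfl; omega)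
  have hlt : j * j < 4 * G.maxDegree := by
    have h : (j : ℝ) < 2 * Real.sqrt (G.maxDegree : ℝ) := by
      rw [← Nat.lt_ceil, ← hk]
      exact Nat.lt_succ_self j
    have h0 : (0 : ℝ) ≤ j := Nat.cast_nonneg j
    have : (j * j : ℝ) < 4 * G.maxDegree := by nlinarith
    exact_mod_cast this
  rw [← hk]
  by_cases h5 : 4 < G.maxDegree
  · refine exists_colouring_of_five_le hconn (m := (j + 1) / 2) (by nlinarith) rfl ?_ ?_
    · obtain ⟨i, hi⟩ := Nat.even_or_odd' (j + 1)
      rcases hi with hi | hi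
      · rw [hi] at hle ⊢
        rw [show 2 * i / 2 = i by omega, show 2 * i - i = i by omega]
        nlinarith
      · rw [hi] at hle ⊢
        rw [show (2 * i + 1) / 2 = i by omega, show 2 * i + 1 - i = i + 1 by omega]
        have : 4 * G.maxDegree ≤ 4 * (i * (i + 1)) + 1 := by nlinarith
        omega
    · obtain ⟨i, hi⟩ := Nat.even_or_odd' j
      rcases hi with rfl | rfl
      · rw [show (2 * i + 1) / 2 = i by omega, show 2 * i + 1 - i = i + 1 by omega]
        cases i with
        | zero => simpa using hpos
        | succ i =>
          rw [Nat.add_sub_cancel]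
          nlinarith
      · rw [show (2 * i + 1 + 1) / 2 = i + 1 by omega, show 2 * i + 1 + 1 - (i + 1) = i + 1 by omega,
          Nat.add_sub_cancel]
        have : 4 * (i * (i + 1)) + 1 < 4 * G.maxDegree := by nlinarith
        omega
  · have hj : j < 4 := by nlinarith
    interval_cases j
    · omega
    · exact exists_colouring_two hconn hedge (by omega)
    · exact exists_colouring_three hconn hedge (by omega)
    · exact exists_colouring_four hconn (by omega) (by omega)
end

section
/- For every Δ ≥ 4, the least number of colours in a distinguishing arc-colouring of the symmetric directed star ↔K_{1,Δ} with no monochromatic 2-path equals ⌈2√Δ⌉. -/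
open Finset in
/-- If `a i ≠ b j` for all `i ≠ j` and the pairs `(a i, b i)` are distinct, then the pairs split
into the diagonal of the common values and the product of the two sets of private values. -/
theorem card_le_add_mul_of_forall_ne {ι κ : Type*} [Fintype ι] [Fintype κ] [DecidableEq κ]
    {a b : ι → κ} (hab : ∀ i j, i ≠ j → a i ≠ b j)
    (hinj : Function.Injective fun i => (a i, b i)) :
    ∃ s p q : ℕ, s + p + q ≤ Fintype.card κ ∧ Fintype.card ι ≤ s + p * q := by
  classical
  set A := univ.image a
  set B := univ.image b
  refine ⟨#(A ∩ B), #(A \ B), #(B \ A), ?_, ?_⟩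
  · have h₁ := card_inter_add_card_sdiff A B
    have h₂ := card_union A B
    have h₃ := card_inter_add_card_sdiff B A
    rw [inter_comm] at h₃
    have h₄ := card_le_univ (A ∪ B)
    omega
  · have hsub : univ.image (fun i => (a i, b i)) ⊆
        (A ∩ B).image (fun x => (x, x)) ∪ (A \ B) ×ˢ (B \ A) := by
      intro x hx
      obtain ⟨i, -, rfl⟩ := mem_image.1 hx
      have hA : a i ∈ A := mem_image_of_mem a (mem_univ i)
      have hB : b i ∈ B := mem_image_of_mem b (mem_univ i)
      by_cases h : a i = b i
      · refine mem_union_left _ (mem_image.2 ⟨a i, mem_inter.2 ⟨hA, h ▸ hB⟩, ?_⟩)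
        rw [← h]
      · refine mem_union_right _ (mem_product.2 ⟨mem_sdiff.2 ⟨hA, ?_⟩, mem_sdiff.2 ⟨hB, ?_⟩⟩)
        · intro h'
          obtain ⟨j, -, hj⟩ := mem_image.1 h'
          by_cases hij : i = j
          · subst hij; exact h hj.symm
          · exact hab i j hij hj.symm
        · intro h'
          obtain ⟨j, -, hj⟩ := mem_image.1 h'
          by_cases hij : j = i
          · subst hij; exact h hj
          · exact hab j i hij hj
    calc Fintype.card ι = #(univ.image fun i => (a i, b i)) := by
          rw [card_image_of_injective _ hinj, card_univ]
      _ ≤ _ := card_le_card hsub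
      _ ≤ _ := card_union_le _ _
      _ ≤ _ := by
          rw [card_product]
          exact Nat.add_le_add_right card_image_le _

theorem four_mul_le_sq_of_le_add_mul {n m s p q : ℕ} (hn : 4 ≤ n) (hm : s + p + q ≤ m)
    (h : n ≤ s + p * q) : 4 * n ≤ m ^ 2 := by
  have hsq : 4 * (p * q) ≤ (p + q) ^ 2 := by
    zify
    nlinarith [sq_nonneg ((p : ℤ) - q)]
  have hle : (s + (p + q)) ^ 2 ≤ m ^ 2 := Nat.pow_le_pow_left (by omega) 2
  by_cases h4 : 4 ≤ s + 2 * (p + q)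
  · nlinarith [Nat.mul_le_mul_left s h4]
  · have : p + q ≤ 1 := by omega
    have hpq : p * q = 0 := by
      rcases Nat.eq_zero_or_pos p with hp | hp
      · simp [hp]
      · simp [show q = 0 by omega]
    omega

/-- A colouring of the symmetric star has no monochromatic 2-path iff every in-arc of the centre
differs in colour from the out-arcs to the other leaves. -/
theorem noMono2Path_star_iff {n m : ℕ} {c : (Fin 1 ⊕ Fin n) → (Fin 1 ⊕ Fin n) → Fin m} :
    NoMono2Path (completeBipartiteGraph (Fin 1) (Fin n)) c ↔
      ∀ i j, i ≠ j → c (.inr i) (.inl 0) ≠ c (.inl 0) (.inr j) := by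
  constructor
  · intro h i j hij
    exact h _ _ _ (by simp) (by simp) (by simpa using hij.symm)
  · rintro h (u | u) (v | v) (w | w) huv hvw hwu
    all_goals simp at huv hvw
    · exact absurd (congrArg Sum.inl (Subsingleton.elim w u)) hwu
    · obtain rfl := Subsingleton.elim v 0
      exact h u w fun e => hwu (by rw [e])

/-- A colouring of the symmetric star with at least two leaves is distinguishing iff no two leaves
have the same pair of colours on their arcs. -/
theorem isDistinguishing_star_iff {n m : ℕ} (hn : 2 ≤ n)
    {c : (Fin 1 ⊕ Fin n) → (Fin 1 ⊕ Fin n) → Fin m} :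
    IsDistinguishing (completeBipartiteGraph (Fin 1) (Fin n)) c ↔
      Function.Injective fun i => (c (.inr i) (.inl 0), c (.inl 0) (.inr i)) := by
  constructor
  · intro h i j hij
    obtain ⟨h₁, h₂⟩ := Prod.ext_iff.1 hij
    dsimp only at h₁ h₂
    let φ : completeBipartiteGraph (Fin 1) (Fin n) ≃g completeBipartiteGraph (Fin 1) (Fin n) :=
      { toEquiv := Equiv.sumCongr (Equiv.refl _) (Equiv.swap i j)
        map_rel_iff' := by rintro (u | u) (v | v) <;> exact Iff.rfl }
    have hφl (u : Fin 1) : φ (.inl u) = .inl u := rfl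
    have hφr (u : Fin n) : φ (.inr u) = .inr (Equiv.swap i j u) := rfl
    have key := h φ (by
      rintro (u | u) (v | v) huv
      all_goals simp at huv
      · obtain rfl := Subsingleton.elim u 0
        rw [hφl, hφr, Equiv.swap_apply_def]
        split_ifs with e e' <;> simp_all
      · obtain rfl := Subsingleton.elim v 0
        rw [hφl, hφr, Equiv.swap_apply_def]
        split_ifs with e e' <;> simp_all) (.inr i)
    rw [hφr, Equiv.swap_apply_left] at key
    exact (Sum.inr_injective key).symm
  · intro hinj φ hφ
    have hadj (i : Fin n) : (completeBipartiteGraph (Fin 1) (Fin n)).Adj (φ (.inl 0)) (φ (.inr i)) :=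
      φ.map_rel_iff.2 (by simp)
    have h0 : φ (.inl 0) = .inl 0 := by
      rcases e : φ (.inl 0) with u | u
      · rw [Subsingleton.elim u 0]
      · have hl (i : Fin n) : φ (.inr i) = .inl 0 := by
          have hi := hadj i
          rcases e' : φ (.inr i) with v | v
          · rw [Subsingleton.elim v 0]
          · simp [e, e'] at hi
        have := φ.injective ((hl ⟨0, by omega⟩).trans (hl ⟨1, by omega⟩).symm)
        simp at this
    rintro (u | i)
    · rw [Subsingleton.elim u 0, h0]
    · have hi := hadj i
      rcases e : φ (.inr i) with v | v
      · simp [h0, e] at hi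
      · have h₁ := hφ (.inr i) (.inl 0) (by simp)
        have h₂ := hφ (.inl 0) (.inr i) (by simp)
        rw [h0, e] at h₁ h₂
        rw [hinj (Prod.ext h₁ h₂)]

theorem exists_star_colouring_iff {n m : ℕ} (hn : 4 ≤ n) :
    (∃ c : (Fin 1 ⊕ Fin n) → (Fin 1 ⊕ Fin n) → Fin m,
        NoMono2Path (completeBipartiteGraph (Fin 1) (Fin n)) c ∧
        IsDistinguishing (completeBipartiteGraph (Fin 1) (Fin n)) c) ↔ 4 * n ≤ m ^ 2 := by
  simp only [noMono2Path_star_iff, isDistinguishing_star_iff (show 2 ≤ n by omega)]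
  constructor
  · rintro ⟨c, hc, hinj⟩
    obtain ⟨s, p, q, hm, h⟩ := card_le_add_mul_of_forall_ne hc hinj
    rw [Fintype.card_fin] at hm h
    exact four_mul_le_sq_of_le_add_mul hn hm h
  · intro h
    obtain ⟨p, q, rfl, hpq⟩ : ∃ p q, m = p + q ∧ n ≤ p * q := by
      obtain ⟨k, rfl | rfl⟩ := Nat.even_or_odd' m
      · exact ⟨k, k, by ring, by nlinarith⟩
      · refine ⟨k, k + 1, by ring, ?_⟩
        ring_nf at h ⊢
        omega
    let f : Fin n → Fin p × Fin q := fun i => finProdFinEquiv.symm (Fin.castLE hpq i)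
    have hf : Function.Injective f :=
      finProdFinEquiv.symm.injective.comp (Fin.castLE_injective hpq)
    refine ⟨fun u v => Sum.elim
      (fun _ => Sum.elim (fun _ => ⟨0, by nlinarith⟩) (fun i => Fin.natAdd p (f i).2) v)
      (fun i => Fin.castAdd q (f i).1) u, ?_, ?_⟩
    · intro i j _ hij
      have := congrArg Fin.val hij
      simp only [Sum.elim_inl, Sum.elim_inr, Fin.val_castAdd, Fin.val_natAdd] at this
      omega
    · intro i j hij
      simp only [Sum.elim_inl, Sum.elim_inr, Prod.mk.injEq, Fin.castAdd_inj,
        Fin.natAdd_inj] at hij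
      exact hf (Prod.ext hij.1 hij.2)

theorem stmt15 (Δ : ℕ) (hΔ : 4 ≤ Δ) :
    sInf {m : ℕ | ∃ c : (Fin 1 ⊕ Fin Δ) → (Fin 1 ⊕ Fin Δ) → Fin m,
        NoMono2Path (completeBipartiteGraph (Fin 1) (Fin Δ)) c ∧
        IsDistinguishing (completeBipartiteGraph (Fin 1) (Fin Δ)) c} =
    ⌈2 * Real.sqrt (Δ : ℝ)⌉₊ := by
  simp only [exists_star_colouring_iff hΔ]
  have hiff (m : ℕ) : 4 * Δ ≤ m ^ 2 ↔ ⌈2 * Real.sqrt (Δ : ℝ)⌉₊ ≤ m := by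
    rw [Nat.ceil_le, ← abs_of_nonneg (show 0 ≤ 2 * Real.sqrt (Δ : ℝ) by positivity),
      ← abs_of_nonneg (Nat.cast_nonneg (α := ℝ) m), ← sq_le_sq, mul_pow,
      Real.sq_sqrt (Nat.cast_nonneg Δ)]
    norm_num
    norm_cast
  simp only [hiff]
  exact isLeast_Ici.csInf_eq
end

section
/- For every k ≥ 1, the least number of colours in a distinguishing arc-colouring of the symmetric directed path ↔P_{2k+1} on 2k+1 vertices with no monochromatic 2-path equals 2. -/
/-- The arc-colouring of a path by the parity of the smaller end of each arc. -/
def minParityColouring (n : ℕ) (u v : Fin n) : Fin 2 :=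
  ⟨min u.val v.val % 2, Nat.mod_lt _ two_pos⟩

theorem noMono2Path_minParityColouring (n : ℕ) :
    NoMono2Path (SimpleGraph.pathGraph n) (minParityColouring n) := by
  intro u v w huv hvw hwu h
  rw [SimpleGraph.pathGraph_adj] at huv hvw
  have hne : w.val ≠ u.val := fun e => hwu (Fin.ext e)
  have h' : min u.val v.val % 2 = min v.val w.val % 2 := congrArg Fin.val h
  omega

/-- An automorphism of a path maps the first vertex to an end of the path. -/
theorem pathGraph_iso_zero {n : ℕ}
    (φ : SimpleGraph.pathGraph (n + 1) ≃g SimpleGraph.pathGraph (n + 1)) :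
    (φ 0).val = 0 ∨ (φ 0).val = n := by
  by_contra! hends
  have hlt := (φ 0).isLt
  have preimage_eq_one : ∀ a : Fin (n + 1), (SimpleGraph.pathGraph (n + 1)).Adj (φ 0) a →
      (φ.symm a).val = 1 := by
    intro a ha
    have h : (SimpleGraph.pathGraph (n + 1)).Adj 0 (φ.symm a) := by
      rw [← φ.map_adj_iff, φ.apply_symm_apply]
      exact ha
    rw [SimpleGraph.pathGraph_adj, Fin.val_zero] at h
    omega
  have hl := preimage_eq_one ⟨(φ 0).val - 1, by omega⟩
    (by rw [SimpleGraph.pathGraph_adj]; dsimp only; omega)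
  have hr := preimage_eq_one ⟨(φ 0).val + 1, by omega⟩
    (by rw [SimpleGraph.pathGraph_adj]; dsimp only; omega)
  have heq := congrArg Fin.val (φ.symm.injective (Fin.ext (hl.trans hr.symm)))
  dsimp only at heq
  omega

/-- An automorphism of a path fixing the first vertex is the identity. -/
theorem pathGraph_iso_eq_of_zero {n : ℕ}
    (φ : SimpleGraph.pathGraph (n + 1) ≃g SimpleGraph.pathGraph (n + 1))
    (h0 : (φ 0).val = 0) (x : Fin (n + 1)) : φ x = x := by
  obtain ⟨i, hi⟩ := x
  induction i using Nat.strong_induction_on with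
  | _ i ih =>
    rcases i with _ | i
    · exact Fin.ext h0
    · have hadj : (SimpleGraph.pathGraph (n + 1)).Adj (φ ⟨i, by omega⟩) (φ ⟨i + 1, hi⟩) :=
        φ.map_adj_iff.2 (SimpleGraph.pathGraph_adj.2 (Or.inl rfl))
      rw [ih i (by omega), SimpleGraph.pathGraph_adj] at hadj
      rcases hadj with h | h
      · exact Fin.ext h.symm
      · have hfix := ih (φ ⟨i + 1, hi⟩).val (by dsimp only at h; omega) (φ ⟨i + 1, hi⟩).isLt
        exact φ.injective hfix

theorem isDistinguishing_minParityColouring (k : ℕ) (hk : 1 ≤ k) :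
    IsDistinguishing (SimpleGraph.pathGraph (2 * k + 1)) (minParityColouring (2 * k + 1)) := by
  intro φ hφ
  refine pathGraph_iso_eq_of_zero φ ((pathGraph_iso_zero φ).resolve_right fun hlast => ?_)
  have h01 : (SimpleGraph.pathGraph (2 * k + 1)).Adj 0 ⟨1, by omega⟩ :=
    SimpleGraph.pathGraph_adj.2 (Or.inl rfl)
  have hcol : min (φ 0).val (φ ⟨1, by omega⟩).val % 2 = min 0 1 % 2 :=
    congrArg Fin.val (hφ _ _ h01)
  have hadj := SimpleGraph.pathGraph_adj.1 (φ.map_adj_iff.2 h01)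
  have hlt := (φ ⟨1, by omega⟩).isLt
  omega

/-- A path on at least three vertices needs two colours to avoid monochromatic 2-paths. -/
theorem NoMono2Path.two_le {n m : ℕ} (hn : 3 ≤ n) {c : Fin n → Fin n → Fin m}
    (hc : NoMono2Path (SimpleGraph.pathGraph n) c) : 2 ≤ m := by
  have h := hc ⟨0, by omega⟩ ⟨1, by omega⟩ ⟨2, by omega⟩
    (SimpleGraph.pathGraph_adj.2 (Or.inl rfl)) (SimpleGraph.pathGraph_adj.2 (Or.inl rfl))
    (by simp)
  have hne := Fin.val_ne_of_ne h
  omega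

theorem stmt16 (k : ℕ) (hk : 1 ≤ k) :
    sInf {m : ℕ | ∃ c : Fin (2 * k + 1) → Fin (2 * k + 1) → Fin m,
        NoMono2Path (SimpleGraph.pathGraph (2 * k + 1)) c ∧
        IsDistinguishing (SimpleGraph.pathGraph (2 * k + 1)) c} = 2 := by
  exact IsLeast.csInf_eq ⟨⟨minParityColouring (2 * k + 1), noMono2Path_minParityColouring _,
    isDistinguishing_minParityColouring k hk⟩, fun _ ⟨_, hc, _⟩ => hc.two_le (by omega)⟩
end

section
/- Let l ≥ 2 be an integer and let n = C(2l+1, l) + 1. Then the least number of colours in a distinguishing arc-colouring of the complete symmetric digraph ↔K_n with no monochromatic 2-path is strictly less than the least number of colours in a distinguishing proper arc-colouring of type I of ↔K_n. -/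
open Finset

/-- A colouring with no monochromatic 2-cycle or 2-path assigns to distinct vertices of a complete
graph incomparable sets of outgoing colours, so Sperner's theorem bounds the number of vertices. -/
theorem IsTypeIColouring.card_le_choose {V : Type*} [Fintype V] [DecidableEq V] {k : ℕ}
    {c : V → V → Fin k} (hc : IsTypeIColouring (⊤ : SimpleGraph V) c) :
    Fintype.card V ≤ k.choose (k / 2) := by
  set out : V → Finset (Fin k) := fun v => (univ.erase v).image (c v)
  have key : ∀ u v, out u ⊆ out v → u = v := by
    intro u v h
    by_contra huv
    have hmem : c u v ∈ out u := mem_image_of_mem _ (by simpa using Ne.symm huv)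
    obtain ⟨w, hw, hcw⟩ := mem_image.1 (h hmem)
    have hwv : w ≠ v := by simpa using hw
    exact hc u v w huv hwv.symm hcw.symm
  have hinj : Function.Injective out := fun u v h => key u v h.subset
  have hanti : IsAntichain (· ⊆ ·) (SetLike.coe (univ.image out)) := by
    intro s hs t ht hst hsub
    obtain ⟨u, -, rfl⟩ := mem_image.1 hs
    obtain ⟨v, -, rfl⟩ := mem_image.1 ht
    exact hst (congrArg out (key u v hsub))
  simpa [card_image_of_injective _ hinj] using hanti.sperner

/-- Colouring all arcs differently is proper of type I and distinguishing. -/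
theorem exists_isTypeIColouring_isDistinguishing {V : Type*} [Fintype V]
    (G : SimpleGraph V) (hG : ∀ v, ∃ w, G.Adj v w) :
    ∃ (k : ℕ) (c : V → V → Fin k), IsTypeIColouring G c ∧ IsDistinguishing G c := by
  refine ⟨_, fun u v => Fintype.equivFin (V × V) (u, v), ?_, ?_⟩
  · intro u v w huv _ h
    have := (Fintype.equivFin (V × V)).injective h
    exact huv.ne (congrArg Prod.fst this)
  · intro φ hφ x
    obtain ⟨y, hxy⟩ := hG x
    exact congrArg Prod.fst ((Fintype.equivFin (V × V)).injective (hφ x y hxy))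

/-- Two rules choosing an element of each nonempty finset, which differ on every finset with at
least two elements. -/
theorem exists_two_choices (α : Type*) :
    ∃ p : Bool → Finset α → Option α, (∀ b, p b ∅ = none) ∧
      (∀ b s, s.Nonempty → ∃ a ∈ s, p b s = some a) ∧
      ∀ s, 2 ≤ #s → p false s ≠ p true s := by
  have h : ∀ s : Finset α, ∃ q : Bool → Option α, (s = ∅ → ∀ b, q b = none) ∧
      (s.Nonempty → ∀ b, ∃ a ∈ s, q b = some a) ∧ (2 ≤ #s → q false ≠ q true) := by
    intro s
    rcases s.eq_empty_or_nonempty with rfl | ⟨x, hx⟩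
    · exact ⟨fun _ => none, by simp⟩
    by_cases hs : 2 ≤ #s
    · obtain ⟨y, hy, hyx⟩ := exists_mem_ne hs x
      refine ⟨fun b => some (if b then x else y), ?_, ?_, ?_⟩
      · rintro rfl; simp at hx
      · intro _ b; cases b <;> simp [hx, hy]
      · intro _; simpa using hyx
    · refine ⟨fun _ => some x, ?_, fun _ _ => ⟨x, hx, rfl⟩, fun h => absurd h hs⟩
      rintro rfl; simp at hx
  choose q hq using h
  exact ⟨fun b s => q s b, fun b => (hq ∅).1 rfl b, fun b s hs => (hq s).2.1 hs b,
    fun s => (hq s).2.2⟩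

/-- Vertices labelled by `l`-subsets of a `2l`-set, with every subset used once or twice, admit a
distinguishing colouring without monochromatic 2-path: arcs between vertices with the same label
get an extra colour, the other arcs a colour in the difference of the labels. -/
theorem exists_noMono2Path_isDistinguishing_of_labelling {V : Type*} {l : ℕ} (hl : 2 ≤ l)
    (A : V → Finset (Fin (2 * l))) (b : V → Bool) (hcard : ∀ v, #(A v) = l)
    (hinj : ∀ u v, A u = A v → b u = b v → u = v) (hsurj : ∀ s, #s = l → ∃ v, A v = s) :
    ∃ c : V → V → Fin (2 * l + 1),
      NoMono2Path (⊤ : SimpleGraph V) c ∧ IsDistinguishing (⊤ : SimpleGraph V) c := by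
  obtain ⟨p, p_empty, p_mem, p_ne⟩ := exists_two_choices (Fin (2 * l))
  have eq_of_subset : ∀ u v, A u ⊆ A v → A u = A v := fun u v h =>
    eq_of_subset_of_card_le h (by simp [hcard])
  have sdiff_nonempty : ∀ u v, A u ≠ A v → (A u \ A v).Nonempty := fun u v h =>
    sdiff_nonempty.2 (mt (eq_of_subset u v) h)
  refine ⟨fun u v => finSuccEquivLast.symm (p (b u) (A u \ A v)), ?_, ?_⟩
  · intro u v w huv hvw hwu h
    replace h := finSuccEquivLast.symm.injective h
    by_cases hA : A u = A v <;> by_cases hA' : A v = A w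
    · have h₁ : b u ≠ b v := fun hb => huv (hinj u v hA hb)
      have h₂ : b v ≠ b w := fun hb => hvw (hinj v w hA' hb)
      refine hwu (hinj w u (hA.trans hA').symm ?_)
      revert h₁ h₂
      cases b u <;> cases b v <;> cases b w <;> simp
    · obtain ⟨a, -, ha⟩ := p_mem (b v) _ (sdiff_nonempty v w hA')
      simp [hA, p_empty, ha] at h
    · obtain ⟨a, -, ha⟩ := p_mem (b u) _ (sdiff_nonempty u v hA)
      rw [ha] at h
      simp [hA', p_empty] at h
    · obtain ⟨a, ham, ha⟩ := p_mem (b u) _ (sdiff_nonempty u v hA)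
      obtain ⟨a', ham', ha'⟩ := p_mem (b v) _ (sdiff_nonempty v w hA')
      obtain rfl : a = a' := Option.some.inj (ha.symm.trans (h.trans ha'))
      exact (mem_sdiff.1 ham).2 (mem_sdiff.1 ham').1
  · intro φ hφ
    have hp : ∀ u v, A u ≠ A v →
        p (b (φ u)) (A (φ u) \ A (φ v)) = p (b u) (A u \ A v) := fun u v h =>
      finSuccEquivLast.symm.injective (hφ u v fun huv => h (congrArg A huv))
    have hA : ∀ u, A (φ u) = A u := by
      intro u
      refine (eq_of_subset _ _ fun a ha => ?_).symm
      obtain ⟨x, hx⟩ : ∃ x, x ∉ A u := by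
        by_contra! h
        have h₁ := hcard u
        rw [eq_univ_iff_forall.2 h, card_univ, Fintype.card_fin] at h₁
        omega
      obtain ⟨v, hv⟩ := hsurj (insert x ((A u).erase a)) (by
        rw [card_insert_of_notMem (by simp [hx]), card_erase_of_mem ha, hcard]; omega)
      have hdiff : A u \ A v = {a} := by
        ext y
        simp only [hv, mem_sdiff, mem_insert, mem_erase, mem_singleton]
        constructor
        · tauto
        · rintro rfl
          refine ⟨ha, ?_⟩
          rintro (rfl | h)
          · exact hx ha
          · exact h.1 rfl
      have huv : A u ≠ A v := by
        intro h
        simp [h] at hdiff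
      obtain ⟨y, hy, hpy⟩ := p_mem (b u) {a} (by simp)
      have h := hp u v huv
      rw [hdiff, hpy, mem_singleton.1 hy] at h
      rcases (A (φ u) \ A (φ v)).eq_empty_or_nonempty with h₀ | h₀
      · simp [h₀, p_empty] at h
      · obtain ⟨z, hz, hpz⟩ := p_mem (b (φ u)) _ h₀
        obtain rfl : z = a := Option.some.inj (hpz.symm.trans h)
        exact (mem_sdiff.1 hz).1
    intro u
    refine hinj _ _ (hA u) ?_
    obtain ⟨v, hv⟩ := hsurj (A u)ᶜ (by
      rw [card_compl, hcard, Fintype.card_fin]; omega)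
    have hdiff : A u \ A v = A u := by ext y; simp [hv]
    have huv : A u ≠ A v := by
      intro h
      have h₁ := hcard u
      rw [← hdiff, h, sdiff_self, bot_eq_empty, card_empty] at h₁
      omega
    have h := hp u v huv
    rw [hA, hA, hdiff] at h
    have hne := p_ne (A u) (by rw [hcard]; exact hl)
    cases h₁ : b (φ u) <;> cases h₂ : b u <;> first | rfl | rw [h₁, h₂] at h
    · exact absurd h hne
    · exact absurd h.symm hne

theorem exists_noMono2Path_isDistinguishing {l n : ℕ} (hl : 2 ≤ l)
    (h₁ : (2 * l).choose l ≤ n) (h₂ : n ≤ 2 * (2 * l).choose l) :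
    ∃ c : Fin n → Fin n → Fin (2 * l + 1),
      NoMono2Path (⊤ : SimpleGraph (Fin n)) c ∧ IsDistinguishing (⊤ : SimpleGraph (Fin n)) c := by
  set S := powersetCard l (univ : Finset (Fin (2 * l))) with hS
  have hScard : #S = (2 * l).choose l := by simp [hS]
  obtain ⟨T, hST, hTS, hT⟩ := exists_subsuperset_card_eq
    (product_subset_product_left (subset_univ {false}) : {false} ×ˢ S ⊆ univ ×ˢ S)
    (by simpa [hScard] using h₁) (by simpa [hScard] using h₂)
  let e := (T.equivFinOfCardEq hT).symm
  refine exists_noMono2Path_isDistinguishing_of_labelling hl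
    (fun v => (e v).1.2) (fun v => (e v).1.1) ?_ ?_ ?_
  · intro v
    exact (mem_powersetCard.1 (mem_product.1 (hTS (e v).2)).2).2
  · intro u v hA hb
    exact e.injective (Subtype.ext (Prod.ext hb hA))
  · intro s hs
    have hsT : (false, s) ∈ T := hST (by simp [hS, hs])
    exact ⟨e.symm ⟨_, hsT⟩, by simp⟩

theorem choose_two_mul_add_one_lt {l : ℕ} (hl : 1 ≤ l) :
    (2 * l + 1).choose l < 2 * (2 * l).choose l := by
  obtain ⟨m, rfl⟩ := Nat.exists_eq_add_of_le' hl
  have h := Nat.choose_succ_right_eq (2 * (m + 1)) m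
  have hpos : 0 < (2 * (m + 1)).choose (m + 1) := Nat.choose_pos (by omega)
  rw [show 2 * (m + 1) - m = m + 2 by omega] at h
  rw [Nat.choose_succ_succ]
  nlinarith

theorem stmt18 (l : ℕ) (hl : 2 ≤ l) (n : ℕ) (hn : n = (2 * l + 1).choose l + 1) :
    sInf {k : ℕ | ∃ c : Fin n → Fin n → Fin k,
        NoMono2Path (⊤ : SimpleGraph (Fin n)) c ∧
        IsDistinguishing (⊤ : SimpleGraph (Fin n)) c} <
    sInf {k : ℕ | ∃ c : Fin n → Fin n → Fin k,
        IsTypeIColouring (⊤ : SimpleGraph (Fin n)) c ∧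
        IsDistinguishing (⊤ : SimpleGraph (Fin n)) c} := by
  have hlt := choose_two_mul_add_one_lt (l := l) (by omega)
  have hle : (2 * l).choose l ≤ (2 * l + 1).choose l := Nat.choose_le_choose l (by omega)
  have : Nontrivial (Fin n) := Fin.nontrivial_iff_two_le.2 (by
    have : 0 < (2 * l + 1).choose l := Nat.choose_pos (by omega)
    omega)
  refine (Nat.sInf_le (exists_noMono2Path_isDistinguishing (n := n) hl
    (by omega) (by omega))).trans_lt (Nat.lt_of_not_le fun hk => ?_)
  obtain ⟨c, hc, -⟩ := Nat.sInf_mem (exists_isTypeIColouring_isDistinguishing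
    (⊤ : SimpleGraph (Fin n)) fun v => (exists_ne v).imp fun _ h => h.symm)
  have hcard := hc.card_le_choose.trans
    ((Nat.choose_le_choose _ hk).trans (Nat.choose_le_middle _ _))
  rw [Fintype.card_fin, show (2 * l + 1) / 2 = l by omega] at hcard
  omega
end
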